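/- Let N ≥ 2, p > 1, α ∈ [0,1] and q > p + α·max(1, (p−1)/(N−1)). Then there exist a bounded weight a : ℝ^N → [0,∞) (α-Hölder continuous if α ∈ (0,1), Lipschitz if α = 1) defining Φ(x,t) = t^p + a(x)·t^q, a boundary datum u^∂ ∈ C^∞(ℝ^N), and t₀ > 0, such that for every t ≥ t₀ there exists a function w : Ω → ℝ with weak gradient g ∈ L¹(Ω;ℝ^N), with w − t·u^∂ bounded and compactly supported in Ω and ∫_Ω Φ(x,|g(x)|) dx < ∞, satisfying ∫_Ω Φ(x,|g(x)|) dx < inf{ ∫_Ω Φ(x, |t·∇u^∂(x) + ∇φ(x)|) dx : φ ∈ C_c^∞(Ω) }. In particular, for the Dirichlet problem with boundary datum t·u^∂ the minimum of the double-phase energy over the Sobolev class of competitors is strictly smaller than the infimum over smooth competitors with the same boundary values (W-minimizer ≠ H-minimizer, 0-form case). -/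

import Mathlib

open MeasureTheory Real Filter
open scoped Topology ENNReal

noncomputable section

/-- `ℝ^N` with the Euclidean structure. -/
abbrev Euc (N : ℕ) := EuclideanSpace ℝ (Fin N)

/-- The open ball of radius `√N` centered at the origin. -/
def Omg (N : ℕ) : Set (Euc N) := Metric.ball 0 (Real.sqrt N)

/-- A smooth function compactly supported in `Ω`. -/
def IsTestFun (N : ℕ) (φ : Euc N → ℝ) : Prop :=
  ContDiff ℝ (⊤ : ℕ∞) φ ∧ HasCompactSupport φ ∧ tsupport φ ⊆ Omg N

/-- `w` is locally integrable on `Ω` and has weak gradient `g ∈ L¹(Ω;ℝ^N)`. -/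
def HasWeakGradOn (N : ℕ) (w : Euc N → ℝ) (g : Euc N → Euc N) : Prop :=
  LocallyIntegrableOn w (Omg N) ∧ IntegrableOn g (Omg N) ∧
  ∀ φ : Euc N → ℝ, IsTestFun N φ → ∀ i : Fin N,
    (∫ x in Omg N, w x * fderiv ℝ φ x (EuclideanSpace.single i 1))
      = - ∫ x in Omg N, g x i * φ x

/-- The point with binary address `w` of the Cantor set in `[0, 1/2]` with contraction ratio `l`. -/
def cantorPt (l : ℝ) (w : ℕ → Bool) : ℝ := (1 / 4) * ∑' i, l ^ i * (if w i then 1 else 0)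

lemma cantorPt_summable {l : ℝ} (h0 : 0 < l) (h1 : l < 1 / 2) (w : ℕ → Bool) :
    Summable (fun i => l ^ i * (if w i then (1 : ℝ) else 0)) := by
  refine Summable.of_nonneg_of_le (fun i => by positivity) (fun i => ?_)
    (summable_geometric_of_lt_one h0.le (by linarith))
  have : 0 < l ^ i := by positivity
  split_ifs <;> linarith

lemma cantorPt_mem_Icc {l : ℝ} (h0 : 0 < l) (h1 : l < 1 / 2) (w : ℕ → Bool) :
    cantorPt l w ∈ Set.Icc (0 : ℝ) (1 / 2) := by
  have hs := cantorPt_summable h0 h1 w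
  have h2 : ∑' i, l ^ i * (if w i then (1 : ℝ) else 0) ≤ ∑' i, l ^ i := by
    refine hs.tsum_le_tsum (fun i => ?_) (summable_geometric_of_lt_one h0.le (by linarith))
    have : 0 < l ^ i := by positivity
    split_ifs <;> linarith
  rw [tsum_geometric_of_lt_one h0.le (by linarith)] at h2
  have h3 : (1 - l)⁻¹ ≤ 2 := by
    rw [inv_le_comm₀ (by linarith) (by norm_num)]; linarith
  have h4 : 0 ≤ ∑' i, l ^ i * (if w i then (1 : ℝ) else 0) := tsum_nonneg fun i => by positivity
  constructor <;> unfold cantorPt <;> linarith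

lemma cantorPt_sub_eq {l : ℝ} (h0 : 0 < l) (h1 : l < 1 / 2) {w w' : ℕ → Bool} {m : ℕ}
    (h : ∀ i < m, w i = w' i) :
    ∃ e : ℝ, |e| ≤ l ^ (m + 1) / (1 - l) ∧ cantorPt l w - cantorPt l w' =
      (1 / 4) * (l ^ m * ((if w m then 1 else 0) - (if w' m then 1 else 0)) + e) := by
  have hs := cantorPt_summable h0 h1 w
  have hs' := cantorPt_summable h0 h1 w'
  have hd := hs.sub hs'
  have hg := summable_geometric_of_lt_one h0.le (show l < 1 by linarith)
  refine ⟨∑' i, (l ^ (i + (m + 1)) * (if w (i + (m + 1)) then (1 : ℝ) else 0)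
    - l ^ (i + (m + 1)) * (if w' (i + (m + 1)) then (1 : ℝ) else 0)), ?_, ?_⟩
  · have hg' : Summable (fun i : ℕ => l ^ (i + (m + 1))) := (summable_nat_add_iff (m + 1)).2 hg
    have : ∑' i : ℕ, l ^ (i + (m + 1)) = l ^ (m + 1) / (1 - l) := by
      simp_rw [pow_add l _ (m + 1)]
      rw [tsum_mul_right, tsum_geometric_of_lt_one h0.le (by linarith)]
      field_simp
    rw [← this, ← Real.norm_eq_abs]
    refine tsum_of_norm_bounded hg'.hasSum fun i => ?_
    have : 0 < l ^ (i + (m + 1)) := by positivity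
    rw [Real.norm_eq_abs, abs_le]
    constructor <;> split_ifs <;> linarith
  · unfold cantorPt
    rw [← mul_sub, ← hs.tsum_sub hs', ← hd.sum_add_tsum_nat_add (m + 1), Finset.sum_range_succ]
    rw [Finset.sum_eq_zero]
    · ring
    · intro i hi
      rw [h i (Finset.mem_range.1 hi), sub_self]

lemma cantorPt_separated {l : ℝ} (h0 : 0 < l) (h1 : l < 1 / 2) {w w' : ℕ → Bool} {m : ℕ}
    (h : ∀ i < m, w i = w' i) (hm : w m ≠ w' m) :
    (1 - 2 * l) / (4 * (1 - l)) * l ^ m ≤ |cantorPt l w - cantorPt l w'| := by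
  obtain ⟨e, he, heq⟩ := cantorPt_sub_eq h0 h1 h
  rw [heq, abs_mul, abs_of_pos (by norm_num : (0 : ℝ) < 1 / 4)]
  have h2 : |l ^ m * ((if w m then (1 : ℝ) else 0) - (if w' m then 1 else 0))| = l ^ m := by
    have : 0 < l ^ m := by positivity
    rcases hw : w m with _ | _ <;> rcases hw' : w' m with _ | _ <;> simp_all [abs_of_pos]
  have h3 := abs_sub_abs_le_abs_sub
    (l ^ m * ((if w m then (1 : ℝ) else 0) - (if w' m then 1 else 0))) (-e)
  rw [abs_neg, sub_neg_eq_add, h2] at h3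
  have h4 : (1 - 2 * l) / (4 * (1 - l)) * l ^ m = 1 / 4 * (l ^ m - l ^ (m + 1) / (1 - l)) := by
    have : 1 - l ≠ 0 := by linarith
    field_simp
    ring
  rw [h4]
  linarith

lemma cantorPt_dist_le {l : ℝ} (h0 : 0 < l) (h1 : l < 1 / 2) {w w' : ℕ → Bool} {m : ℕ}
    (h : ∀ i < m, w i = w' i) : |cantorPt l w - cantorPt l w'| ≤ l ^ m := by
  obtain ⟨e, he, heq⟩ := cantorPt_sub_eq h0 h1 h
  rw [heq, abs_mul, abs_of_pos (by norm_num : (0 : ℝ) < 1 / 4)]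
  have hp : 0 < l ^ m := by positivity
  have h2 : |l ^ m * ((if w m then (1 : ℝ) else 0) - (if w' m then 1 else 0))| ≤ l ^ m := by
    rw [abs_le]
    split_ifs <;> constructor <;> linarith
  have h5 : l ^ (m + 1) / (1 - l) ≤ l ^ m := by
    rw [div_le_iff₀ (by linarith), pow_succ]
    nlinarith
  have := abs_add_le (l ^ m * ((if w m then (1 : ℝ) else 0) - (if w' m then 1 else 0))) e
  linarith

lemma continuous_cantorPt {l : ℝ} (h0 : 0 < l) (h1 : l < 1 / 2) : Continuous (cantorPt l) := by
  unfold cantorPt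
  refine continuous_const.mul (continuous_tsum (u := fun i => l ^ i) (fun i => ?_)
    (summable_geometric_of_lt_one h0.le (by linarith)) fun i w => ?_)
  · refine continuous_const.mul ?_
    exact (continuous_of_discreteTopology (f := fun b : Bool => if b then (1 : ℝ) else 0)).comp
      (continuous_apply i)
  · have : 0 < l ^ i := by positivity
    rw [Real.norm_eq_abs, abs_le]
    constructor <;> split_ifs <;> linarith

/-- The fair coin-tossing measure on binary sequences. -/
def coinMeasure : Measure (ℕ → Bool) :=
  Measure.infinitePi fun _ => (PMF.uniformOfFintype Bool).toMeasure

instance : IsProbabilityMeasure coinMeasure := by unfold coinMeasure; infer_instance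

lemma coinMeasure_cylinder (n : ℕ) (w : ℕ → Bool) :
    coinMeasure {w' | ∀ i < n, w' i = w i} = ENNReal.ofReal ((1 / 2) ^ n) := by
  have : {w' : ℕ → Bool | ∀ i < n, w' i = w i} =
      Set.pi (Finset.range n) (fun i => {w i}) := by
    ext w'; simp
  rw [this, coinMeasure, Measure.infinitePi_pi _ (fun i _ => measurableSet_singleton _)]
  simp only [PMF.toMeasure_apply_singleton _ _ (measurableSet_singleton _),
    PMF.uniformOfFintype_apply, Fintype.card_bool, Finset.prod_const, Finset.card_range]
  rw [ENNReal.ofReal_pow (by norm_num), one_div, ENNReal.ofReal_inv_of_pos (by norm_num)]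
  simp

/-- `C` carries the probability measure `μ`, which is upper `δ`-regular, and `dist(·, C)^(-γ)` is
locally integrable for `0 < γ < κ`. -/
structure IsRegularSupport {X : Type*} [PseudoMetricSpace X] [Zero X] [MeasureSpace X]
    (C : Set X) (μ : Measure X) (δ κ : ℝ) : Prop where
  isProb : IsProbabilityMeasure μ
  nonempty : C.Nonempty
  ball_le : ∃ c : ℝ, 0 < c ∧ ∀ x r, 0 < r → μ (Metric.closedBall x r) ≤ ENNReal.ofReal (c * r ^ δ)
  ball_eq_zero : ∀ x r, Disjoint (Metric.closedBall x r) C → μ (Metric.closedBall x r) = 0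
  lintegral_lt_top : ∀ γ R : ℝ, 0 < γ → γ < κ →
    ∫⁻ x in Metric.closedBall (0 : X) R, ENNReal.ofReal (Metric.infDist x C) ^ (-γ) < ⊤

lemma cantor_ball_le {δ l : ℝ} (hδ : 0 < δ) (h0 : 0 < l) (h1 : l < 1 / 2)
    (hl : l ^ δ = 1 / 2) : ∃ c : ℝ, 0 < c ∧ ∀ x r, 0 < r →
      (coinMeasure.map (cantorPt l)) (Metric.closedBall x r) ≤ ENNReal.ofReal (c * r ^ δ) := by
  set κ := (1 - 2 * l) / (4 * (1 - l)) with hκ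
  have hκ0 : 0 < κ := div_pos (by linarith) (by linarith)
  refine ⟨2 * (2 / κ) ^ δ, by positivity, fun x r hr => ?_⟩
  have hmul : 2 * (2 / κ) ^ δ * r ^ δ = 2 * (2 * r / κ) ^ δ := by
    rw [mul_assoc, ← Real.mul_rpow (by positivity) hr.le]; congr 2; ring
  rw [hmul]
  have hm : Measurable (cantorPt l) := (continuous_cantorPt h0 h1).measurable
  rcases le_or_gt (2 * r / κ) 1 with h | h
  · obtain ⟨n, hn1, hn2⟩ := exists_nat_pow_near_of_lt_one (show 0 < 2 * r / κ by positivity) h h0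
      (by linarith)
    rw [Measure.map_apply hm Metric.isClosed_closedBall.measurableSet]
    rcases (cantorPt l ⁻¹' Metric.closedBall x r).eq_empty_or_nonempty with he | ⟨w, hw⟩
    · rw [he]; simp
    have hsub : cantorPt l ⁻¹' Metric.closedBall x r ⊆ {w' | ∀ i < n, w' i = w i} := by
      intro w' hw'
      by_contra hne
      have hex : ∃ i, w' i ≠ w i := by
        simp only [Set.mem_ofPred_eq, not_forall] at hne
        obtain ⟨i, _, hi⟩ := hne
        exact ⟨i, hi⟩
      have hfind := Nat.find_spec hex
      have hmin : ∀ i < Nat.find hex, w' i = w i := fun i hi => by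
        simpa using Nat.find_min hex hi
      have hlt : Nat.find hex < n := by
        by_contra hge
        exact hne fun i hi => hmin i (by omega)
      have hsep := cantorPt_separated h0 h1 hmin hfind
      have hd : |cantorPt l w' - cantorPt l w| ≤ 2 * r := by
        have h1 : dist (cantorPt l w') x ≤ r := hw'
        have h2 : dist (cantorPt l w) x ≤ r := hw
        rw [← Real.dist_eq]
        linarith [dist_triangle_right (cantorPt l w') (cantorPt l w) x]
      have h3 : l ^ Nat.find hex ≤ 2 * r / κ := by
        rw [le_div_iff₀ hκ0, mul_comm]; exact hsep.trans hd
      have h4 : l ^ n < l ^ Nat.find hex := pow_lt_pow_right_of_lt_one₀ h0 (by linarith) hlt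
      linarith
    refine (measure_mono hsub).trans ?_
    rw [coinMeasure_cylinder]
    refine ENNReal.ofReal_le_ofReal ?_
    have h5 : (l ^ (n + 1)) ^ δ ≤ (2 * r / κ) ^ δ :=
      Real.rpow_le_rpow (by positivity) hn1.le hδ.le
    have h6 : (l ^ (n + 1)) ^ δ = (1 / 2) ^ (n + 1) := by
      rw [← Real.rpow_natCast, ← Real.rpow_mul h0.le, mul_comm, Real.rpow_mul h0.le, hl,
        Real.rpow_natCast]
    rw [h6, pow_succ] at h5
    linarith
  · have : IsProbabilityMeasure (coinMeasure.map (cantorPt l)) :=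
      Measure.isProbabilityMeasure_map hm.aemeasurable
    refine prob_le_one.trans ?_
    rw [← ENNReal.ofReal_one]
    refine ENNReal.ofReal_le_ofReal ?_
    have := Real.one_le_rpow h.le hδ.le
    linarith

lemma cantor_volume_thickening {l : ℝ} (h0 : 0 < l) (h1 : l < 1 / 2) (n : ℕ) :
    volume {x : ℝ | Metric.infDist x (Set.range (cantorPt l)) < l ^ n} ≤
      ENNReal.ofReal (4 * (2 * l) ^ n) := by
  classical
  let ext : (Fin n → Bool) → ℕ → Bool := fun v i => if h : i < n then v ⟨i, h⟩ else false
  have hsub : {x : ℝ | Metric.infDist x (Set.range (cantorPt l)) < l ^ n} ⊆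
      ⋃ v : Fin n → Bool, Metric.closedBall (cantorPt l (ext v)) (2 * l ^ n) := by
    intro x hx
    obtain ⟨_, ⟨w, rfl⟩, hw⟩ := (Metric.infDist_lt_iff (Set.range_nonempty _)).1 hx
    refine Set.mem_iUnion.2 ⟨fun i => w i, ?_⟩
    have := cantorPt_dist_le h0 h1 (w := w) (w' := ext fun i => w i) (m := n)
      (fun i hi => by simp [ext, hi])
    rw [← Real.dist_eq] at this
    rw [Metric.mem_closedBall]
    linarith [dist_triangle x (cantorPt l w) (cantorPt l (ext fun i => w i))]
  refine (measure_mono hsub).trans ((measure_iUnion_fintype_le _ _).trans ?_)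
  simp only [Real.volume_closedBall, Finset.sum_const, Finset.card_univ, Fintype.card_pi,
    Fintype.card_bool, Finset.prod_const, Fintype.card_fin, nsmul_eq_mul]
  rw [← ENNReal.ofReal_natCast, ← ENNReal.ofReal_mul (by positivity)]
  refine ENNReal.ofReal_le_ofReal (le_of_eq ?_)
  push_cast
  rw [mul_pow]; ring

lemma cantor_lintegral_lt_top {δ l γ : ℝ} (h0 : 0 < l) (h1 : l < 1 / 2)
    (hl : l ^ δ = 1 / 2) (hγ : 0 < γ) (hγ1 : γ < 1 - δ) (R : ℝ) :
    ∫⁻ x in Metric.closedBall (0 : ℝ) R,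
      ENNReal.ofReal (Metric.infDist x (Set.range (cantorPt l))) ^ (-γ) < ⊤ := by
  set C := Set.range (cantorPt l)
  set A : ℕ → Set ℝ := fun n => {x : ℝ | Metric.infDist x C < l ^ n}
  have hA : ∀ n, MeasurableSet (A n) := fun n =>
    measurableSet_lt (Metric.continuous_infDist_pt C).measurable measurable_const
  set b : ℕ → ℝ≥0∞ := fun n => ENNReal.ofReal (l ^ (n + 1)) ^ (-γ)
  have hb1 : ∀ n, 1 ≤ b n := fun n => by
    have : ENNReal.ofReal (l ^ (n + 1)) ≤ 1 := by
      rw [← ENNReal.ofReal_one]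
      exact ENNReal.ofReal_le_ofReal (pow_le_one₀ h0.le (by linarith))
    simp only [b, ENNReal.rpow_neg]
    exact ENNReal.one_le_inv.2 (ENNReal.rpow_le_one this hγ.le)
  have hanti : ∀ {x y : ℝ≥0∞}, x ≤ y → y ^ (-γ) ≤ x ^ (-γ) := fun h => by
    simp only [ENNReal.rpow_neg]
    exact ENNReal.inv_le_inv.2 (ENNReal.rpow_le_rpow h hγ.le)
  have hpt : ∀ x, ENNReal.ofReal (Metric.infDist x C) ^ (-γ) ≤
      1 + ∑' n, (A n).indicator (fun _ => b n) x := by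
    intro x
    rcases le_or_gt 1 (Metric.infDist x C) with h | h
    · refine le_trans ?_ le_self_add
      have := hanti (show (1 : ℝ≥0∞) ≤ ENNReal.ofReal (Metric.infDist x C) by
        rw [← ENNReal.ofReal_one]; exact ENNReal.ofReal_le_ofReal h)
      simpa using this
    refine le_trans ?_ le_add_self
    rcases (Metric.infDist_nonneg (x := x) (s := C)).eq_or_lt with h' | h'
    · have : ∑' n, (A n).indicator (fun _ => b n) x = ⊤ := by
        refine top_unique ?_
        calc (⊤ : ℝ≥0∞) = ∑' _ : ℕ, (1 : ℝ≥0∞) := by simp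
          _ ≤ _ := ENNReal.tsum_le_tsum fun n => by
            rw [Set.indicator_of_mem (show x ∈ A n by
              simp only [A, Set.mem_ofPred_eq, ← h']; positivity)]
            exact hb1 n
      rw [this]; exact le_top
    · obtain ⟨n, hn1, hn2⟩ := exists_nat_pow_near_of_lt_one h' h.le h0 (by linarith)
      rcases hn2.eq_or_lt with hn2 | hn2
      · have hn : 1 ≤ n := by
          by_contra hn
          have : n = 0 := by omega
          simp [this] at hn2; linarith
        refine le_trans ?_ (ENNReal.le_tsum (n - 1))
        rw [Set.indicator_of_mem (show x ∈ A (n - 1) by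
          simp only [A, Set.mem_ofPred_eq, hn2]
          exact pow_lt_pow_right_of_lt_one₀ h0 (by linarith) (by omega))]
        simp only [b]
        rw [Nat.sub_add_cancel hn, hn2]
      · refine le_trans ?_ (ENNReal.le_tsum n)
        rw [Set.indicator_of_mem (show x ∈ A n from hn2)]
        exact hanti (ENNReal.ofReal_le_ofReal hn1.le)
  have hrat : 2 * l * l ^ (-γ) < 1 := by
    have h2 : 2 * l * l ^ (-γ) = l ^ (1 - γ - δ) := by
      have h3 : l ^ (-δ) = 2 := by rw [Real.rpow_neg h0.le, hl]; norm_num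
      rw [show 1 - γ - δ = -δ + 1 + -γ by ring, Real.rpow_add h0, Real.rpow_add h0, h3,
        Real.rpow_one]
    rw [h2]
    exact Real.rpow_lt_one h0.le (by linarith) (by linarith)
  have hterm : ∀ n, b n * volume (A n) ≤
      ENNReal.ofReal (4 * l ^ (-γ)) * ENNReal.ofReal (2 * l * l ^ (-γ)) ^ n := by
    intro n
    refine (mul_le_mul_right (cantor_volume_thickening h0 h1 n) _).trans (le_of_eq ?_)
    simp only [b]
    rw [ENNReal.ofReal_rpow_of_pos (by positivity), ← ENNReal.ofReal_mul (by positivity),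
      ← ENNReal.ofReal_pow (by positivity), ← ENNReal.ofReal_mul (by positivity)]
    congr 1
    have : (l ^ (n + 1)) ^ (-γ) = (l ^ (-γ)) ^ (n + 1) := by
      rw [← Real.rpow_natCast, ← Real.rpow_mul h0.le, mul_comm, Real.rpow_mul h0.le,
        Real.rpow_natCast]
    rw [this, mul_pow (2 * l)]; ring
  calc ∫⁻ x in Metric.closedBall (0 : ℝ) R, ENNReal.ofReal (Metric.infDist x C) ^ (-γ)
      ≤ ∫⁻ x in Metric.closedBall (0 : ℝ) R, (1 + ∑' n, (A n).indicator (fun _ => b n) x) :=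
        lintegral_mono hpt
    _ = volume (Metric.closedBall (0 : ℝ) R) +
        ∫⁻ x in Metric.closedBall (0 : ℝ) R, ∑' n, (A n).indicator (fun _ => b n) x := by
        rw [lintegral_add_left measurable_const]; simp
    _ ≤ volume (Metric.closedBall (0 : ℝ) R) +
        ∫⁻ x, ∑' n, (A n).indicator (fun _ => b n) x := by
        gcongr; exact Measure.restrict_le_self
    _ = volume (Metric.closedBall (0 : ℝ) R) + ∑' n, b n * volume (A n) := by
        rw [lintegral_tsum fun n => (measurable_const.indicator (hA n)).aemeasurable]
        simp_rw [lintegral_indicator_const (hA _)]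
    _ ≤ volume (Metric.closedBall (0 : ℝ) R) +
        ∑' n, ENNReal.ofReal (4 * l ^ (-γ)) * ENNReal.ofReal (2 * l * l ^ (-γ)) ^ n := by
        exact add_le_add le_rfl (ENNReal.tsum_le_tsum hterm)
    _ < ⊤ := by
        rw [ENNReal.tsum_mul_left, ENNReal.tsum_geometric]
        refine ENNReal.add_lt_top.2 ⟨measure_closedBall_lt_top,
          ENNReal.mul_lt_top ENNReal.ofReal_lt_top (ENNReal.inv_lt_top.2 ?_)⟩
        rw [tsub_pos_iff_lt, ← ENNReal.ofReal_one]
        exact (ENNReal.ofReal_lt_ofReal_iff one_pos).2 hrat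

/-- Cantor sets of any dimension `δ ∈ (0, 1)`. -/
lemma exists_isRegularSupport {δ : ℝ} (hδ : 0 < δ) (hδ1 : δ < 1) :
    ∃ (C : Set ℝ) (μ : Measure ℝ), C ⊆ Set.Icc 0 (1 / 2) ∧ μ (Set.Icc 0 (1 / 2))ᶜ = 0 ∧
      IsRegularSupport C μ δ (1 - δ) := by
  set l : ℝ := (1 / 2) ^ (1 / δ)
  have h0 : 0 < l := by positivity
  have h1 : l < 1 / 2 := by
    have : (1 / 2 : ℝ) ^ (1 / δ) < (1 / 2 : ℝ) ^ (1 : ℝ) :=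
      Real.rpow_lt_rpow_of_exponent_gt (by norm_num) (by norm_num) (by
        rw [lt_div_iff₀ hδ]; linarith)
    rwa [Real.rpow_one] at this
  have hl : l ^ δ = 1 / 2 := by
    rw [← Real.rpow_mul (by norm_num), one_div_mul_cancel hδ.ne', Real.rpow_one]
  have hm : Measurable (cantorPt l) := (continuous_cantorPt h0 h1).measurable
  refine ⟨Set.range (cantorPt l), coinMeasure.map (cantorPt l), ?_, ?_,
    Measure.isProbabilityMeasure_map hm.aemeasurable, Set.range_nonempty _,
    cantor_ball_le hδ h0 h1 hl, fun x r h => ?_,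
    fun γ R hγ hγ1 => cantor_lintegral_lt_top h0 h1 hl hγ hγ1 R⟩
  · rintro _ ⟨w, rfl⟩
    exact cantorPt_mem_Icc h0 h1 w
  · rw [Measure.map_apply hm measurableSet_Icc.compl]
    convert measure_empty (μ := coinMeasure)
    ext w
    simpa using cantorPt_mem_Icc h0 h1 w
  · rw [Measure.map_apply hm Metric.isClosed_closedBall.measurableSet]
    convert measure_empty (μ := coinMeasure)
    ext w
    simp only [Set.mem_preimage, Set.mem_empty_iff_false, iff_false]
    exact fun hw => Set.disjoint_left.1 h hw ⟨w, rfl⟩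

lemma lintegral_pi_prod {k : ℕ} (μ : Measure ℝ) [SigmaFinite μ] (f : ℝ → ℝ≥0∞)
    (hf : Measurable f) :
    ∫⁻ x : Fin k → ℝ, ∏ i, f (x i) ∂(Measure.pi fun _ => μ) = (∫⁻ s, f s ∂μ) ^ k := by
  induction k with
  | zero => simp [lintegral_const]
  | succ k ih =>
    have hmp := (measurePreserving_piFinSuccAbove (fun _ : Fin (k + 1) => μ) 0)
    have hmeas : ∀ n, Measurable fun x : Fin n → ℝ => ∏ i, f (x i) := fun n =>
      Finset.measurable_prod _ fun i _ => hf.comp (measurable_pi_apply i)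
    have h := hmp.lintegral_comp (f := fun z : ℝ × (Fin k → ℝ) => f z.1 * ∏ i, f (z.2 i))
      ((hf.comp measurable_fst).mul ((hmeas k).comp measurable_snd))
    have h2 : ∀ x : Fin (k + 1) → ℝ, ∏ i, f (x i) =
        f ((MeasurableEquiv.piFinSuccAbove (fun _ => ℝ) 0 x).1) *
          ∏ i, f ((MeasurableEquiv.piFinSuccAbove (fun _ => ℝ) 0 x).2 i) := fun x => by
      rw [Fin.prod_univ_succ]; rfl
    simp_rw [h2]
    rw [h, lintegral_prod_mul hf.aemeasurable (hmeas k).aemeasurable, ih, pow_succ']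

lemma infDist_apply_le {k : ℕ} {C : Set ℝ} (hC : C.Nonempty) (x : Fin k → ℝ) (i : Fin k) :
    Metric.infDist (x i) C ≤ Metric.infDist x (Set.pi Set.univ fun _ => C) := by
  refine (Metric.le_infDist (Set.univ_pi_nonempty_iff.2 fun _ => hC)).2 fun y hy => ?_
  exact (Metric.infDist_le_dist_of_mem (hy i (Set.mem_univ i))).trans (dist_le_pi_dist x y i)

lemma IsRegularSupport.pi {k : ℕ} (hk : 0 < k) {C : Set ℝ} {μ : Measure ℝ} {δ κ : ℝ}
    (h : IsRegularSupport C μ δ κ) :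
    IsRegularSupport (Set.pi Set.univ fun _ : Fin k => C) (Measure.pi fun _ : Fin k => μ)
      (k * δ) (k * κ) := by
  have := h.isProb
  have hk' : (0 : ℝ) < k := Nat.cast_pos.2 hk
  refine ⟨inferInstance, Set.univ_pi_nonempty_iff.2 fun _ => h.nonempty, ?_, fun x r hd => ?_,
    fun γ R hγ hγκ => ?_⟩
  · obtain ⟨c, hc, hb⟩ := h.ball_le
    refine ⟨c ^ k, by positivity, fun x r hr => ?_⟩
    rw [Measure.pi_closedBall _ _ hr.le]
    calc ∏ i, μ (Metric.closedBall (x i) r) ≤ ∏ _i : Fin k, ENNReal.ofReal (c * r ^ δ) :=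
          Finset.prod_le_prod' fun i _ => hb _ r hr
      _ = ENNReal.ofReal (c ^ k * r ^ (k * δ)) := by
          rw [Finset.prod_const, Finset.card_univ, Fintype.card_fin,
            ← ENNReal.ofReal_pow (by positivity), mul_pow, mul_comm (k : ℝ) δ,
            Real.rpow_mul hr.le, Real.rpow_natCast]
  · rcases lt_or_ge r 0 with hr | hr
    · rw [Metric.closedBall_eq_empty.2 hr, measure_empty]
    rw [Measure.pi_closedBall _ _ hr]
    by_contra hne
    have : ∀ i, ∃ y ∈ C, dist y (x i) ≤ r := fun i => by
      have h1 : μ (Metric.closedBall (x i) r) ≠ 0 :=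
        Finset.prod_ne_zero_iff.1 hne i (Finset.mem_univ i)
      have h2 := fun hd => h1 (h.ball_eq_zero _ _ hd)
      obtain ⟨y, hy1, hy2⟩ := Set.not_disjoint_iff.1 h2
      exact ⟨y, hy2, hy1⟩
    choose y hy hyr using this
    exact Set.disjoint_left.1 hd (Metric.mem_closedBall.2 ((dist_pi_le_iff hr).2 hyr))
      (fun i _ => hy i)
  · rcases lt_or_ge R 0 with hR | hR
    · rw [Metric.closedBall_eq_empty.2 hR]; simp
    set f : ℝ → ℝ≥0∞ := fun s => ENNReal.ofReal (Metric.infDist s C) ^ (-(γ / k))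
    have hf : Measurable f := by
      have := (Metric.continuous_infDist_pt C).measurable
      exact this.ennreal_ofReal.pow_const _
    have hγk : 0 < γ / k := by positivity
    have h1 := h.lintegral_lt_top (γ / k) R hγk (by rw [div_lt_iff₀ hk', mul_comm]; exact hγκ)
    have hpt : ∀ x : Fin k → ℝ,
        ENNReal.ofReal (Metric.infDist x (Set.pi Set.univ fun _ : Fin k => C)) ^ (-γ) ≤
          ∏ i, f (x i) := by
      intro x
      have h2 : ENNReal.ofReal (Metric.infDist x (Set.pi Set.univ fun _ : Fin k => C)) ^ (-γ) =
          ∏ _i : Fin k, ENNReal.ofReal (Metric.infDist x (Set.pi Set.univ fun _ : Fin k => C)) ^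
            (-(γ / k)) := by
        rw [Finset.prod_const, Finset.card_univ, Fintype.card_fin, ← ENNReal.rpow_natCast,
          ← ENNReal.rpow_mul]
        congr 1
        field_simp
      rw [h2]
      refine Finset.prod_le_prod' fun i _ => ?_
      simp only [f, ENNReal.rpow_neg]
      exact ENNReal.inv_le_inv.2 (ENNReal.rpow_le_rpow
        (ENNReal.ofReal_le_ofReal (infDist_apply_le h.nonempty x i)) hγk.le)
    refine (lintegral_mono hpt).trans_lt ?_
    rw [closedBall_pi _ hR, volume_pi, Measure.restrict_pi_pi]
    simp only [Pi.zero_apply]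
    rw [lintegral_pi_prod _ f hf]
    exact ENNReal.pow_lt_top h1

lemma exists_lipschitz_smoothTransition :
    ∃ L : ℝ, 0 < L ∧ ∀ x y, |smoothTransition x - smoothTransition y| ≤ L * |x - y| := by
  have hc : Continuous (deriv smoothTransition) :=
    (smoothTransition.contDiff (n := 1)).continuous_deriv le_rfl
  obtain ⟨M, hM⟩ := isCompact_Icc.exists_bound_of_continuousOn (s := Set.Icc (0 : ℝ) 1)
    hc.continuousOn
  have hlip : ∀ x ∈ Set.Icc (0 : ℝ) 1, ∀ y ∈ Set.Icc (0 : ℝ) 1,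
      |smoothTransition x - smoothTransition y| ≤ M * |x - y| := by
    intro x hx y hy
    exact Convex.norm_image_sub_le_of_norm_deriv_le
      (fun z _ => (smoothTransition.contDiff (n := 1)).differentiable (by simp) z) hM
      (convex_Icc 0 1) hy hx
  refine ⟨max M 1, by positivity, fun x y => ?_⟩
  rw [← smoothTransition.projIcc (x := x), ← smoothTransition.projIcc (x := y)]
  refine (hlip _ (Subtype.coe_prop _) _ (Subtype.coe_prop _)).trans ?_
  exact mul_le_mul (le_max_left _ _) (Set.abs_projIcc_sub_projIcc zero_le_one) (abs_nonneg _)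
    (by positivity)

lemma abs_smoothTransition_div_sub_le {L : ℝ} (hL : 0 < L)
    (hlip : ∀ x y, |smoothTransition x - smoothTransition y| ≤ L * |x - y|)
    {s s' r r' : ℝ} (hr : 0 < r) (hr' : 0 < r') :
    |smoothTransition (s / r) - smoothTransition (s' / r')| ≤
      2 * L / r * (|s - s'| + |r - r'|) := by
  have key : ∀ {s r : ℝ}, 0 < r →
      r * (Set.projIcc (0 : ℝ) 1 zero_le_one (s / r) : ℝ) = max 0 (min r s) := by
    intro s r hr
    rw [Set.coe_projIcc, mul_max_of_nonneg _ _ hr.le, mul_min_of_nonneg _ _ hr.le,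
      mul_div_cancel₀ _ hr.ne']
    simp
  rw [← smoothTransition.projIcc (x := s / r), ← smoothTransition.projIcc (x := s' / r')]
  refine (hlip _ _).trans ?_
  have h1 := key (s := s) hr
  have h2 := key (s := s') hr'
  obtain ⟨ht0, ht1⟩ := (Set.projIcc (0 : ℝ) 1 zero_le_one (s' / r')).2
  set a : ℝ := ↑(Set.projIcc (0 : ℝ) 1 zero_le_one (s / r))
  set b : ℝ := ↑(Set.projIcc (0 : ℝ) 1 zero_le_one (s' / r'))
  have h3 : |max 0 (min r s) - max 0 (min r' s')| ≤ |s - s'| + |r - r'| := by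
    have := abs_max_sub_max_le_max 0 (min r s) 0 (min r' s')
    have h4 := abs_min_sub_min_le_max r s r' s'
    rw [sub_self, abs_zero, max_eq_right (abs_nonneg (min r s - min r' s'))] at this
    refine this.trans (h4.trans (max_le ?_ ?_)) <;> linarith [abs_nonneg (s - s'), abs_nonneg (r - r')]
  have h5 : |r * a - r * b| ≤ |s - s'| + |r - r'| + |r - r'| := by
    have h6 : r * a - r * b = (r * a - r' * b) - (r - r') * b := by ring
    rw [h6, h1, h2]
    refine (abs_sub _ _).trans ?_
    rw [abs_mul, abs_of_nonneg ht0]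
    have := mul_le_mul_of_nonneg_left ht1 (abs_nonneg (r - r'))
    linarith
  rw [← mul_sub, abs_mul, abs_of_pos hr] at h5
  rw [div_mul_eq_mul_div, le_div_iff₀ hr]
  have := mul_le_mul_of_nonneg_left h5 hL.le
  nlinarith [abs_nonneg (s - s'), abs_nonneg (r - r')]

/-- The `μ`-average of the transitions of width `r` starting at the points of the line. -/
def avgStep (μ : Measure ℝ) (s r : ℝ) : ℝ := ∫ y, smoothTransition ((s - y) / r) ∂μ

lemma integrable_avgStep (μ : Measure ℝ) [IsProbabilityMeasure μ] (s r : ℝ) :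
    Integrable (fun y => smoothTransition ((s - y) / r)) μ := by
  refine Integrable.of_bound (C := 1) ?_ (.of_forall fun y => ?_)
  · exact (smoothTransition.continuous.comp (by fun_prop)).aestronglyMeasurable
  · rw [Real.norm_eq_abs, abs_of_nonneg (smoothTransition.nonneg _)]
    exact smoothTransition.le_one _

lemma avgStep_mem_Icc (μ : Measure ℝ) [IsProbabilityMeasure μ] (s r : ℝ) :
    avgStep μ s r ∈ Set.Icc (0 : ℝ) 1 := by
  refine ⟨integral_nonneg fun y => smoothTransition.nonneg _, ?_⟩
  have := integral_mono (integrable_avgStep μ s r) (integrable_const 1)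
    (fun y => smoothTransition.le_one _)
  simpa [avgStep] using this

lemma abs_avgStep_sub_le {L : ℝ} (hL : 0 < L)
    (hlip : ∀ x y, |smoothTransition x - smoothTransition y| ≤ L * |x - y|)
    (μ : Measure ℝ) [IsProbabilityMeasure μ] {s s' r r' : ℝ} (hr : 0 < r) (hr' : 0 < r') :
    |avgStep μ s r - avgStep μ s' r'| ≤ 2 * L / r * (|s - s'| + |r - r'|) *
      μ.real (Metric.closedBall s (r + (|s - s'| + |r - r'|))) := by
  set B := Metric.closedBall s (r + (|s - s'| + |r - r'|))
  set M := 2 * L / r * (|s - s'| + |r - r'|)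
  have hM : 0 ≤ M := by positivity
  unfold avgStep
  rw [← integral_sub (integrable_avgStep μ s r) (integrable_avgStep μ s' r')]
  have hB : MeasurableSet B := Metric.isClosed_closedBall.measurableSet
  have hle : ∀ y, ‖smoothTransition ((s - y) / r) - smoothTransition ((s' - y) / r')‖ ≤
      B.indicator (fun _ => M) y := by
    intro y
    rw [Real.norm_eq_abs]
    by_cases hy : y ∈ B
    · rw [Set.indicator_of_mem hy]
      have := abs_smoothTransition_div_sub_le hL hlip (s := s - y) (s' := s' - y) hr hr'
      simpa using this
    · rw [Set.indicator_of_notMem hy]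
      have hy' : r + (|s - s'| + |r - r'|) < |y - s| := by
        simpa [B, Real.dist_eq] using hy
      have h1 := le_abs_self (s - s')
      have h2 := neg_abs_le (s - s')
      have h3 := le_abs_self (r - r')
      have h4 := neg_abs_le (r - r')
      rcases lt_abs.1 hy' with h | h
      · rw [smoothTransition.zero_of_nonpos (div_nonpos_of_nonpos_of_nonneg (by linarith) hr.le),
          smoothTransition.zero_of_nonpos (div_nonpos_of_nonpos_of_nonneg (by linarith) hr'.le)]
        simp
      · rw [smoothTransition.one_of_one_le ((one_le_div hr).2 (by linarith)),
          smoothTransition.one_of_one_le ((one_le_div hr').2 (by linarith))]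
        simp
  refine (norm_integral_le_of_norm_le ((integrable_const M).indicator hB)
    (.of_forall hle)).trans (le_of_eq ?_)
  rw [integral_indicator_const _ hB, smul_eq_mul, mul_comm]

lemma avgStep_eq_zero (μ : Measure ℝ) (hμ : μ (Set.Icc 0 (1 / 2))ᶜ = 0) {s r : ℝ}
    (hr : 0 ≤ r) (hs : s ≤ 0) : avgStep μ s r = 0 := by
  refine integral_eq_zero_of_ae ?_
  have : ∀ᵐ y ∂μ, y ∈ Set.Icc (0 : ℝ) (1 / 2) := hμ
  filter_upwards [this] with y hy
  exact smoothTransition.zero_of_nonpos (div_nonpos_of_nonpos_of_nonneg (by linarith [hy.1]) hr)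

lemma avgStep_eq_one (μ : Measure ℝ) [IsProbabilityMeasure μ]
    (hμ : μ (Set.Icc 0 (1 / 2))ᶜ = 0) {s r : ℝ}
    (hr : 0 < r) (hs : 1 / 2 + r ≤ s) : avgStep μ s r = 1 := by
  have : ∀ᵐ y ∂μ, y ∈ Set.Icc (0 : ℝ) (1 / 2) := hμ
  have h2 : avgStep μ s r = ∫ _, (1 : ℝ) ∂μ := by
    refine integral_congr_ae ?_
    filter_upwards [this] with y hy
    exact smoothTransition.one_of_one_le ((one_le_div hr).2 (by linarith [hy.2]))
  rw [h2]; simp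

lemma contDiff_avgStep (μ : Measure ℝ) [IsProbabilityMeasure μ]
    (hμ : μ (Set.Icc 0 (1 / 2))ᶜ = 0) :
    ContDiff ℝ (⊤ : ℕ∞) fun s => avgStep μ s (1 / 4) := by
  set h : ℝ → ℝ := fun τ => smoothTransition (τ / (1 / 4)) * smoothTransition (2 - τ)
  have hsm : ContDiff ℝ (⊤ : ℕ∞) h :=
    (smoothTransition.contDiff.comp (by fun_prop)).mul
      (smoothTransition.contDiff.comp (by fun_prop))
  have hcs : HasCompactSupport h := by
    refine HasCompactSupport.intro (isCompact_Icc (a := (0 : ℝ)) (b := 2)) fun τ hτ => ?_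
    simp only [h]
    rcases lt_or_ge τ 0 with h0 | h0
    · rw [smoothTransition.zero_of_nonpos (by linarith), zero_mul]
    · have : 2 < τ := by
        by_contra h2
        exact hτ ⟨h0, not_lt.1 h2⟩
      rw [smoothTransition.zero_of_nonpos (x := 2 - τ) (by linarith), mul_zero]
  have hconv := hcs.contDiff_convolution_right (ContinuousLinearMap.mul ℝ ℝ) (μ := μ)
    (f := fun _ => (1 : ℝ)) (locallyIntegrable_const 1) hsm
  have hsupp : ∀ᵐ y ∂μ, y ∈ Set.Icc (0 : ℝ) (1 / 2) := hμ
  rw [contDiff_iff_contDiffAt]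
  intro s
  rcases lt_or_ge s 1 with hs | hs
  · refine (hconv.contDiffAt (x := s)).congr_of_eventuallyEq ?_
    filter_upwards [Iio_mem_nhds hs] with s' hs'
    simp only [convolution_def, avgStep, ContinuousLinearMap.mul_apply', one_mul, h]
    refine integral_congr_ae ?_
    filter_upwards [hsupp] with y hy
    have : s' < 1 := hs'
    rw [smoothTransition.one_of_one_le (x := 2 - (s' - y)) (by linarith [hy.1]), mul_one]
  · refine (contDiffAt_const (c := (1 : ℝ))).congr_of_eventuallyEq ?_
    filter_upwards [Ioi_mem_nhds (show (3 / 4 : ℝ) < s by linarith)] with s' hs'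
    have : 3 / 4 < s' := hs'
    exact avgStep_eq_one μ hμ (by norm_num) (by linarith)

/-- The vector of partial derivatives (with junk value `0` where they do not exist). -/
def partials {N : ℕ} (u : Euc N → ℝ) (x : Euc N) : Euc N :=
  WithLp.toLp 2 fun i => lineDeriv ℝ u x (EuclideanSpace.single i 1)

lemma IsTestFun.exists_lipschitzWith {N : ℕ} {φ : Euc N → ℝ} (h : IsTestFun N φ) :
    ∃ K, LipschitzWith K φ :=
  ⟨_, (ContDiff.lipschitzWith_of_hasCompactSupport h.2.1 h.1 (by simp)).choose_spec⟩

lemma norm_le_of_forall_abs_le {N : ℕ} {x : Euc N} {c : ℝ} (hc : 0 ≤ c)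
    (h : ∀ i, |x i| ≤ c) : ‖x‖ ≤ √N * c := by
  rw [EuclideanSpace.norm_eq]
  calc √(∑ i, ‖x i‖ ^ 2) ≤ √(∑ _i : Fin N, c ^ 2) := by
        refine Real.sqrt_le_sqrt (Finset.sum_le_sum fun i _ => ?_)
        exact pow_le_pow_left₀ (norm_nonneg _) (h i) 2
    _ = √N * c := by
        rw [Finset.sum_const, Finset.card_univ, Fintype.card_fin, nsmul_eq_mul,
          Real.sqrt_mul (by positivity), Real.sqrt_sq hc]

lemma hasWeakGradOn_of_approx {N : ℕ} {u : Euc N → ℝ} {un : ℕ → Euc N → ℝ} {Cn : ℕ → NNReal}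
    (hlip : ∀ n, LipschitzWith (Cn n) (un n)) (hbd : ∀ n x, |un n x| ≤ 1) {H : Euc N → ℝ}
    (hH : IntegrableOn H (Omg N))
    (hder : ∀ i n, ∀ᵐ x ∂(volume.restrict (Omg N)),
      |lineDeriv ℝ (un n) x (EuclideanSpace.single i 1)| ≤ H x)
    (hev : ∀ᵐ x : Euc N, ∀ᶠ n in atTop, un n =ᶠ[𝓝 x] u) :
    HasWeakGradOn N u (partials u) := by
  set ν := (volume : Measure (Euc N)).restrict (Omg N)
  have hev' : ∀ᵐ x ∂ν, ∀ᶠ n in atTop, un n =ᶠ[𝓝 x] u := ae_restrict_of_ae hev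
  have hlim : ∀ᵐ x ∂ν, Tendsto (fun n => un n x) atTop (𝓝 (u x)) := by
    filter_upwards [hev'] with x hx
    exact tendsto_const_nhds.congr' (hx.mono fun n hn => hn.eq_of_nhds.symm)
  have hlimd : ∀ i, ∀ᵐ x ∂ν, Tendsto
      (fun n => lineDeriv ℝ (un n) x (EuclideanSpace.single i 1)) atTop
      (𝓝 (partials u x i)) := by
    intro i
    filter_upwards [hev'] with x hx
    refine tendsto_const_nhds.congr' (hx.mono fun n hn => ?_)
    exact hn.symm.lineDeriv_eq
  have hum : AEStronglyMeasurable u ν :=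
    aestronglyMeasurable_of_tendsto_ae atTop
      (fun n => (hlip n).continuous.aestronglyMeasurable) hlim
  have hdm : ∀ i n, AEStronglyMeasurable
      (fun x => lineDeriv ℝ (un n) x (EuclideanSpace.single i 1)) ν := fun i n =>
    (measurable_lineDeriv (hlip n).continuous).aestronglyMeasurable
  have hgm : ∀ i, AEStronglyMeasurable (fun x => partials u x i) ν := fun i =>
    aestronglyMeasurable_of_tendsto_ae atTop (hdm i) (hlimd i)
  have hub : ∀ᵐ x ∂ν, ‖u x‖ ≤ 1 := by
    filter_upwards [hlim] with x hx
    exact le_of_tendsto hx.norm (.of_forall fun n => hbd n x)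
  have hgb : ∀ i, ∀ᵐ x ∂ν, ‖partials u x i‖ ≤ H x := by
    intro i
    filter_upwards [hlimd i, ae_all_iff.2 (hder i)] with x hx hx'
    exact le_of_tendsto hx.norm (.of_forall fun n => hx' n)
  have hgi : ∀ i, Integrable (fun x => partials u x i) ν := fun i => hH.mono' (hgm i) (hgb i)
  have hΩfin : IsFiniteMeasure ν := ⟨by
    simp only [ν, Measure.restrict_apply_univ]; exact measure_ball_lt_top⟩
  refine ⟨?_, ?_, ?_⟩
  · have : IntegrableOn u (Omg N) := Integrable.of_bound hum 1 hub
    exact this.locallyIntegrableOn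
  · have h1 : Integrable (fun x => (WithLp.ofLp (partials u x) : Fin N → ℝ)) ν :=
      Integrable.of_eval hgi
    exact (PiLp.continuousLinearEquiv 2 ℝ (fun _ : Fin N => ℝ)).symm.toContinuousLinearMap
      |>.integrable_comp h1
  · intro φ hφ i
    obtain ⟨D, hD⟩ := hφ.exists_lipschitzWith
    have hdiff : ∀ x, DifferentiableAt ℝ φ x := fun x => hφ.1.differentiable (by simp) x
    have hcf : Continuous fun x => fderiv ℝ φ x (EuclideanSpace.single i 1) :=
      (hφ.1.continuous_fderiv (by simp)).clm_apply continuous_const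
    have hφi : Integrable (fun x => fderiv ℝ φ x (EuclideanSpace.single i 1)) ν :=
      ((hcf.integrable_of_hasCompactSupport
        (hφ.2.1.fderiv_apply ℝ _))).restrict
    obtain ⟨M, hM⟩ := hφ.1.continuous.bounded_above_of_compact_support hφ.2.1
    have hIBP : ∀ n, ∫ x in Omg N, un n x * fderiv ℝ φ x (EuclideanSpace.single i 1) =
        -∫ x in Omg N, lineDeriv ℝ (un n) x (EuclideanSpace.single i 1) * φ x := by
      intro n
      have h1 := LipschitzWith.integral_lineDeriv_mul_eq (μ := volume) (hlip n) hD hφ.2.1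
        (EuclideanSpace.single i 1)
      have h2 : ∫ x in Omg N, un n x * fderiv ℝ φ x (EuclideanSpace.single i 1) =
          ∫ x, un n x * fderiv ℝ φ x (EuclideanSpace.single i 1) := by
        refine setIntegral_eq_integral_of_forall_compl_eq_zero fun x hx => ?_
        have : fderiv ℝ φ x = 0 := by
          by_contra h0
          exact hx (hφ.2.2 (support_fderiv_subset ℝ h0))
        simp [this]
      have h3 : ∫ x in Omg N, lineDeriv ℝ (un n) x (EuclideanSpace.single i 1) * φ x =
          ∫ x, lineDeriv ℝ (un n) x (EuclideanSpace.single i 1) * φ x := by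
        refine setIntegral_eq_integral_of_forall_compl_eq_zero fun x hx => ?_
        rw [image_eq_zero_of_notMem_tsupport fun h => hx (hφ.2.2 h), mul_zero]
      rw [h2, h3, h1, ← integral_neg]
      refine integral_congr_ae (.of_forall fun x => ?_)
      simp only [(hdiff x).lineDeriv_eq_fderiv, map_neg]
      ring
    have hL : Tendsto (fun n => ∫ x in Omg N, un n x * fderiv ℝ φ x (EuclideanSpace.single i 1))
        atTop (𝓝 (∫ x in Omg N, u x * fderiv ℝ φ x (EuclideanSpace.single i 1))) := by
      refine tendsto_integral_of_dominated_convergence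
        (fun x => ‖fderiv ℝ φ x (EuclideanSpace.single i 1)‖)
        (fun n => ((hlip n).continuous.mul hcf).aestronglyMeasurable) hφi.norm
        (fun n => .of_forall fun x => ?_) ?_
      · rw [norm_mul]
        exact mul_le_of_le_one_left (norm_nonneg _) (hbd n x)
      · filter_upwards [hlim] with x hx using hx.mul_const _
    have hR : Tendsto
        (fun n => ∫ x in Omg N, lineDeriv ℝ (un n) x (EuclideanSpace.single i 1) * φ x)
        atTop (𝓝 (∫ x in Omg N, partials u x i * φ x)) := by
      refine tendsto_integral_of_dominated_convergence (fun x => H x * M)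
        (fun n => (hdm i n).mul hφ.1.continuous.aestronglyMeasurable) (hH.mul_const M)
        (fun n => ?_) ?_
      · filter_upwards [hder i n] with x hx
        rw [norm_mul]
        exact mul_le_mul hx (hM x) (norm_nonneg _) ((abs_nonneg _).trans hx)
      · filter_upwards [hlimd i] with x hx using hx.mul_const _
    exact tendsto_nhds_unique hL (hR.neg.congr fun n => (hIBP n).symm)

lemma HasWeakGradOn.const_mul {N : ℕ} {u : Euc N → ℝ} {g : Euc N → Euc N}
    (h : HasWeakGradOn N u g) (t : ℝ) :
    HasWeakGradOn N (fun x => t * u x) (fun x => t • g x) := by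
  refine ⟨fun x hx => ?_, h.2.1.smul t, fun φ hφ i => ?_⟩
  · obtain ⟨s, hs, hu⟩ := h.1 x hx
    exact ⟨s, hs, hu.const_mul t⟩
  · simp only [mul_assoc, PiLp.smul_apply, smul_eq_mul]
    rw [integral_const_mul, integral_const_mul, h.2.2 φ hφ i, mul_neg]

/-- The distance to `C`, truncated at `1 / 4`. -/
def cutDist {X : Type*} [PseudoMetricSpace X] (C : Set X) (x : X) : ℝ :=
  min (1 / 4) (Metric.infDist x C)

section CutDist

variable {X : Type*} [PseudoMetricSpace X] (C : Set X)

lemma cutDist_nonneg (x : X) : 0 ≤ cutDist C x := le_min (by norm_num) Metric.infDist_nonneg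

lemma cutDist_le_quarter (x : X) : cutDist C x ≤ 1 / 4 := min_le_left _ _

lemma cutDist_le_infDist (x : X) : cutDist C x ≤ Metric.infDist x C := min_le_right _ _

lemma abs_cutDist_sub_le (x y : X) : |cutDist C x - cutDist C y| ≤ dist x y := by
  have h := abs_min_sub_min_le_max (1 / 4 : ℝ) (Metric.infDist x C) (1 / 4) (Metric.infDist y C)
  rw [sub_self, abs_zero, max_eq_right (abs_nonneg _)] at h
  exact h.trans (by simpa [Real.dist_eq] using (Metric.lipschitz_infDist_pt C).dist_le_mul x y)

lemma lipschitzWith_cutDist : LipschitzWith 1 (cutDist C) :=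
  LipschitzWith.of_dist_le_mul fun x y => by
    simpa [Real.dist_eq] using abs_cutDist_sub_le C x y

end CutDist

/-- All coordinates of a point but the first, as a point of `Fin k → ℝ`. -/
def tl {k : ℕ} (x : Euc (k + 1)) : Fin k → ℝ := fun i => x i.succ

section Coordinates

variable {k : ℕ}

lemma abs_apply_sub_le_dist {N : ℕ} (x y : Euc N) (i : Fin N) : |x i - y i| ≤ dist x y := by
  have := PiLp.norm_apply_le (x - y) i
  rwa [PiLp.sub_apply, Real.norm_eq_abs, ← dist_eq_norm] at this

lemma dist_tl_le (x y : Euc (k + 1)) : dist (tl x) (tl y) ≤ dist x y :=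
  (dist_pi_le_iff dist_nonneg).2 fun i => by
    rw [Real.dist_eq]
    exact abs_apply_sub_le_dist x y i.succ

lemma continuous_tl : Continuous (tl : Euc (k + 1) → Fin k → ℝ) := by
  unfold tl; fun_prop

/-- Splitting off the first coordinate. -/
def splitE (k : ℕ) : Euc (k + 1) ≃ᵐ ℝ × (Fin k → ℝ) :=
  (MeasurableEquiv.toLp 2 (Fin (k + 1) → ℝ)).symm.trans
    (MeasurableEquiv.piFinSuccAbove (fun _ => ℝ) 0)

lemma splitE_apply (x : Euc (k + 1)) : splitE k x = (x 0, tl x) := rfl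

lemma measurePreserving_splitE : MeasurePreserving (splitE k) :=
  (volume_preserving_piFinSuccAbove (fun _ : Fin (k + 1) => ℝ) 0).comp
    (EuclideanSpace.volume_preserving_symm_measurableEquiv_toLp (Fin (k + 1)))

/-- Prepending a first coordinate. -/
def joinE (s : ℝ) (z : Fin k → ℝ) : Euc (k + 1) := WithLp.toLp 2 (Fin.cons s z)

@[simp] lemma joinE_zero (s : ℝ) (z : Fin k → ℝ) : joinE s z 0 = s := rfl

@[simp] lemma tl_joinE (s : ℝ) (z : Fin k → ℝ) : tl (joinE s z) = z := rfl

lemma splitE_symm_apply (s : ℝ) (z : Fin k → ℝ) : (splitE k).symm (s, z) = joinE s z := by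
  rw [MeasurableEquiv.symm_apply_eq, splitE_apply, joinE_zero, tl_joinE]

lemma continuous_joinE : Continuous fun z : ℝ × (Fin k → ℝ) => joinE z.1 z.2 := by
  refine (PiLp.continuous_toLp 2 _).comp (continuous_pi fun i => ?_)
  refine Fin.cases ?_ (fun j => ?_) i
  · exact continuous_fst
  · exact (continuous_apply j).comp continuous_snd

lemma lintegral_euc_eq (F : Euc (k + 1) → ℝ≥0∞) :
    ∫⁻ x, F x = ∫⁻ z : ℝ × (Fin k → ℝ), F (joinE z.1 z.2) := by
  rw [← (measurePreserving_splitE (k := k)).symm.lintegral_comp_emb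
    (splitE k).symm.measurableEmbedding]
  exact lintegral_congr fun z => by rw [← splitE_symm_apply]

end Coordinates

section StepOfWidth

variable {k : ℕ} (μ : Measure ℝ) [IsProbabilityMeasure μ] {ρ : Euc (k + 1) → ℝ}

lemma lipschitzWith_avgStep {ε : ℝ} (hε : 0 < ε) (hρ : LipschitzWith 1 ρ) (hρε : ∀ x, ε ≤ ρ x) :
    ∃ D, LipschitzWith D fun x => avgStep μ (x 0) (ρ x) := by
  obtain ⟨L, hL, hlip⟩ := exists_lipschitz_smoothTransition
  refine ⟨⟨4 * L / ε, by positivity⟩, LipschitzWith.of_dist_le_mul fun x y => ?_⟩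
  have hx := hε.trans_le (hρε x)
  refine (abs_avgStep_sub_le hL hlip μ hx (hε.trans_le (hρε y))).trans ?_
  have h1 := abs_apply_sub_le_dist x y 0
  have h2 : |ρ x - ρ y| ≤ dist x y := by simpa [Real.dist_eq] using hρ.dist_le_mul x y
  calc 2 * L / ρ x * (|x 0 - y 0| + |ρ x - ρ y|) * μ.real _
      ≤ 2 * L / ε * (dist x y + dist x y) * 1 := by
        gcongr
        · exact hρε x
        · exact measureReal_le_one
    _ = 4 * L / ε * dist x y := by ring

lemma exists_lineDeriv_avgStep_le :
    ∃ L : ℝ, 0 < L ∧ ∀ ρ : Euc (k + 1) → ℝ, LipschitzWith 1 ρ → (∀ x, 0 < ρ x) → ∀ x i,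
      |lineDeriv ℝ (fun x => avgStep μ (x 0) (ρ x)) x (EuclideanSpace.single i 1)| ≤
        L / ρ x * μ.real (Metric.closedBall (x 0) (2 * ρ x)) := by
  obtain ⟨L, hL, hlip⟩ := exists_lipschitz_smoothTransition
  refine ⟨4 * L, by positivity, fun ρ hρ hpos x i => ?_⟩
  have hx := hpos x
  have hev : ∀ᶠ y in 𝓝 x, dist x y < ρ x / 2 := by
    have : Metric.ball x (ρ x / 2) ∈ 𝓝 x := Metric.ball_mem_nhds _ (by positivity)
    filter_upwards [this] with y hy
    rwa [dist_comm]
  have hbd : ∀ᶠ y in 𝓝 x, ‖avgStep μ (y 0) (ρ y) - avgStep μ (x 0) (ρ x)‖ ≤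
      4 * L / ρ x * μ.real (Metric.closedBall (x 0) (2 * ρ x)) * ‖y - x‖ := by
    filter_upwards [hev] with y hy
    rw [← dist_eq_norm, dist_comm, Real.dist_eq, ← dist_eq_norm, dist_comm y]
    refine (abs_avgStep_sub_le hL hlip μ hx (hpos y)).trans ?_
    have h1 := abs_apply_sub_le_dist x y 0
    have h2 : |ρ x - ρ y| ≤ dist x y := by simpa [Real.dist_eq] using hρ.dist_le_mul x y
    calc 2 * L / ρ x * (|x 0 - y 0| + |ρ x - ρ y|) * μ.real _
        ≤ 2 * L / ρ x * (dist x y + dist x y) *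
          μ.real (Metric.closedBall (x 0) (2 * ρ x)) := by
          gcongr
          · exact measure_ne_top _ _
          · linarith
      _ = _ := by ring
  have := norm_lineDeriv_le_of_lip' (𝕜 := ℝ) (v := EuclideanSpace.single i (1 : ℝ))
    (by positivity) hbd
  simpa using this

end StepOfWidth

lemma IsRegularSupport.div_mul_measure_le {C : Set ℝ} {μ : Measure ℝ} {B p γ : ℝ}
    (h : IsRegularSupport C μ (1 - B) B) (hp : 1 < p) (hγ : 0 < γ) {L : ℝ} (hL : 0 < L) :
    ∃ M : ℝ, 0 < M ∧ ∀ s ρ, 0 < ρ →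
      ENNReal.ofReal ((L / ρ * μ.real (Metric.closedBall s (2 * ρ))) ^ p) ≤
        ENNReal.ofReal (M * ρ ^ (-(B * p - γ))) *
          ENNReal.ofReal (Metric.infDist s C) ^ (-γ) := by
  have := h.isProb
  obtain ⟨c, hc, hb⟩ := h.ball_le
  refine ⟨(L * (c * 2 ^ (1 - B))) ^ p * 2 ^ γ, by positivity, fun s ρ hρ => ?_⟩
  rcases lt_or_ge (2 * ρ) (Metric.infDist s C) with hd | hd
  · have h0 : μ (Metric.closedBall s (2 * ρ)) = 0 :=
      h.ball_eq_zero _ _ (Metric.disjoint_closedBall_of_lt_infDist hd)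
    simp [Measure.real, h0, Real.zero_rpow (by linarith : p ≠ 0)]
  have hm : μ.real (Metric.closedBall s (2 * ρ)) ≤ c * (2 * ρ) ^ (1 - B) :=
    ENNReal.toReal_le_of_le_ofReal (by positivity) (hb s (2 * ρ) (by positivity))
  have h1 : (L / ρ * μ.real (Metric.closedBall s (2 * ρ))) ^ p ≤
      (L * (c * 2 ^ (1 - B))) ^ p * 2 ^ γ * ρ ^ (-(B * p - γ)) * (2 * ρ) ^ (-γ) := by
    calc (L / ρ * μ.real (Metric.closedBall s (2 * ρ))) ^ p
        ≤ (L / ρ * (c * (2 * ρ) ^ (1 - B))) ^ p := by gcongr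
      _ = (L * (c * 2 ^ (1 - B)) * ρ ^ (-B)) ^ p := by
          congr 1
          rw [Real.mul_rpow (by norm_num) hρ.le, Real.rpow_sub hρ, Real.rpow_neg hρ.le,
            Real.rpow_one]
          field_simp
      _ = _ := by
          rw [Real.mul_rpow (by positivity) (by positivity), ← Real.rpow_mul hρ.le,
            Real.mul_rpow (by norm_num) hρ.le, Real.rpow_neg (by norm_num : (0:ℝ) ≤ 2)]
          have : ρ ^ (-B * p) = ρ ^ (-(B * p - γ)) * ρ ^ (-γ) := by
            rw [← Real.rpow_add hρ]; ring_nf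
          rw [this]
          field_simp
  refine (ENNReal.ofReal_le_ofReal h1).trans ?_
  rw [ENNReal.ofReal_mul (by positivity)]
  gcongr
  rw [← ENNReal.ofReal_rpow_of_pos (by positivity), ENNReal.rpow_neg, ENNReal.rpow_neg]
  gcongr

/-- A majorant of the `p`-th power of the gradient of `steepStep`, up to a constant. -/
def gradMajorant {k : ℕ} (C : Set ℝ) (K : Set (Fin k → ℝ)) (β γ : ℝ) (x : Euc (k + 1)) : ℝ≥0∞ :=
  (ENNReal.ofReal (4 ^ β) + ENNReal.ofReal (Metric.infDist (tl x) K) ^ (-β)) *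
    ENNReal.ofReal (Metric.infDist (x 0) C) ^ (-γ)

/-- A function with boundary values `avgStep μ · (1 / 4)` whose transition steepens
to width zero over the points of `K`. -/
def steepStep {k : ℕ} (μ : Measure ℝ) (K : Set (Fin k → ℝ)) (x : Euc (k + 1)) : ℝ :=
  if cutDist K (tl x) = 0 then avgStep μ (x 0) (1 / 4) else avgStep μ (x 0) (cutDist K (tl x))

/-- Lipschitz approximation of `steepStep`. -/
def steepStepApprox {k : ℕ} (μ : Measure ℝ) (K : Set (Fin k → ℝ)) (n : ℕ) (x : Euc (k + 1)) : ℝ :=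
  avgStep μ (x 0) (max (1 / (n + 4)) (cutDist K (tl x)))

section SteepStep

variable {k : ℕ}

lemma measurable_gradMajorant (C : Set ℝ) (K : Set (Fin k → ℝ)) (β γ : ℝ) :
    Measurable (gradMajorant C K β γ) := by
  have h1 : Measurable fun x : Euc (k + 1) => Metric.infDist (tl x) K :=
    ((Metric.continuous_infDist_pt K).comp continuous_tl).measurable
  have h2 : Measurable fun x : Euc (k + 1) => Metric.infDist (x 0) C :=
    ((Metric.continuous_infDist_pt C).comp (by fun_prop)).measurable
  unfold gradMajorant
  fun_prop

lemma setLIntegral_gradMajorant_lt_top {C : Set ℝ} {μ : Measure ℝ} {K : Set (Fin k → ℝ)}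
    {ν : Measure (Fin k → ℝ)} {δ δ' A B β γ : ℝ} (hC : IsRegularSupport C μ δ B)
    (hK : IsRegularSupport K ν δ' A) (hβ : 0 < β) (hβA : β < A) (hγ : 0 < γ) (hγB : γ < B) :
    ∫⁻ x in Omg (k + 1), gradMajorant C K β γ x < ⊤ := by
  set R : ℝ := √((k + 1 : ℕ) : ℝ)
  set f : ℝ → ℝ≥0∞ := fun s => ENNReal.ofReal (Metric.infDist s C) ^ (-γ)
  set g : (Fin k → ℝ) → ℝ≥0∞ := fun z =>
    ENNReal.ofReal (4 ^ β) + ENNReal.ofReal (Metric.infDist z K) ^ (-β)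
  have hf : Measurable f := by
    have := (Metric.continuous_infDist_pt C).measurable
    fun_prop
  have hg : Measurable g := by
    have := (Metric.continuous_infDist_pt K).measurable
    fun_prop
  set S : Set (ℝ × (Fin k → ℝ)) := Metric.closedBall 0 R ×ˢ Metric.closedBall 0 R
  have hsub : Omg (k + 1) ⊆ splitE k ⁻¹' S := by
    intro x hx
    have hx' : ‖x‖ < R := mem_ball_zero_iff.1 hx
    refine ⟨?_, ?_⟩
    · simpa [splitE_apply] using (PiLp.norm_apply_le x 0).trans hx'.le
    · simp only [splitE_apply, mem_closedBall_zero_iff]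
      exact (pi_norm_le_iff_of_nonneg (by positivity)).2 fun i =>
        (PiLp.norm_apply_le x i.succ).trans hx'.le
  calc ∫⁻ x in Omg (k + 1), gradMajorant C K β γ x
      ≤ ∫⁻ x in splitE k ⁻¹' S, gradMajorant C K β γ x := lintegral_mono_set hsub
    _ = ∫⁻ z in S, f z.1 * g z.2 := by
        rw [← measurePreserving_splitE.setLIntegral_comp_preimage_emb
          (splitE k).measurableEmbedding]
        exact lintegral_congr fun x => mul_comm _ _
    _ = (∫⁻ s in Metric.closedBall 0 R, f s) * ∫⁻ z in Metric.closedBall 0 R, g z := by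
        rw [Measure.volume_eq_prod, ← Measure.prod_restrict,
          lintegral_prod_mul hf.aemeasurable hg.aemeasurable]
    _ < ⊤ := by
        refine ENNReal.mul_lt_top (hC.lintegral_lt_top γ R hγ hγB) ?_
        rw [lintegral_add_left measurable_const]
        refine ENNReal.add_lt_top.2 ⟨?_, hK.lintegral_lt_top β R hβ hβA⟩
        rw [lintegral_const, Measure.restrict_apply_univ]
        exact ENNReal.mul_lt_top ENNReal.ofReal_lt_top measure_closedBall_lt_top

lemma ofReal_rpow_neg_le {R ρ β : ℝ} (hβ : 0 < β) (hR : 0 ≤ R)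
    (h : min (1 / 4) R ≤ ρ) :
    ENNReal.ofReal (ρ ^ (-β)) ≤ ENNReal.ofReal (4 ^ β) + ENNReal.ofReal R ^ (-β) := by
  rcases hR.eq_or_lt with rfl | hR
  · simp [hβ]
  rcases min_le_iff.1 h with h | h
  · refine le_add_right (ENNReal.ofReal_le_ofReal ?_)
    calc ρ ^ (-β) ≤ (1 / 4) ^ (-β) :=
          Real.rpow_le_rpow_of_nonpos (by norm_num) h (by linarith)
      _ = 4 ^ β := by rw [one_div, Real.inv_rpow (by norm_num), Real.rpow_neg (by norm_num), inv_inv]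
  · refine le_add_left ?_
    rw [ENNReal.ofReal_rpow_of_pos hR]
    exact ENNReal.ofReal_le_ofReal (Real.rpow_le_rpow_of_nonpos hR h (by linarith))

lemma lipschitzWith_cutDist_tl (K : Set (Fin k → ℝ)) :
    LipschitzWith 1 fun x : Euc (k + 1) => cutDist K (tl x) :=
  LipschitzWith.of_dist_le_mul fun x y => by
    simpa [Real.dist_eq] using (abs_cutDist_sub_le K (tl x) (tl y)).trans (dist_tl_le x y)

section Approx

variable (K : Set (Fin k → ℝ)) (n : ℕ)

lemma lipschitzWith_max_cutDist_tl :
    LipschitzWith 1 fun x : Euc (k + 1) => max (1 / ((n : ℝ) + 4)) (cutDist K (tl x)) := by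
  simpa [max_comm] using (lipschitzWith_cutDist_tl K).max_const (1 / ((n : ℝ) + 4))

lemma max_cutDist_pos (z : Fin k → ℝ) : 0 < max (1 / ((n : ℝ) + 4)) (cutDist K z) :=
  lt_max_of_lt_left (by positivity)

lemma eventually_steepStepApprox_eq (μ : Measure ℝ) {x : Euc (k + 1)}
    (hx : 0 < cutDist K (tl x)) :
    ∀ᶠ n : ℕ in atTop, 1 / ((n : ℝ) + 4) ≤ cutDist K (tl x) ∧
      steepStepApprox μ K n =ᶠ[𝓝 x] steepStep μ K := by
  have hlim : Tendsto (fun n : ℕ => 1 / ((n : ℝ) + 4)) atTop (𝓝 0) := by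
    simp_rw [one_div]
    exact tendsto_inv_atTop_zero.comp
      (tendsto_atTop_add_const_right _ _ tendsto_natCast_atTop_atTop)
  filter_upwards [hlim.eventually_lt_const hx] with n hn
  refine ⟨hn.le, ?_⟩
  have hc : ContinuousAt (fun y : Euc (k + 1) => cutDist K (tl y)) x :=
    (lipschitzWith_cutDist_tl K).continuous.continuousAt
  filter_upwards [hc.eventually_const_lt hn] with y hy
  have h0 : 0 < cutDist K (tl y) := lt_trans (by positivity) hy
  rw [steepStepApprox, steepStep, if_neg h0.ne', max_eq_right hy.le]

end Approx

/-- The modulating coefficient. -/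
def weight (C : Set ℝ) (K : Set (Fin k → ℝ)) (α : ℝ) (x : Euc (k + 1)) : ℝ :=
  if 2 * cutDist K (tl x) < cutDist C (x 0) then
    (cutDist C (x 0) - 2 * cutDist K (tl x)) ^ α
  else 0

end SteepStep

section SteepStepEnergy

variable {k : ℕ}

lemma exists_lineDeriv_steepStepApprox_le {C : Set ℝ} {μ : Measure ℝ} {K : Set (Fin k → ℝ)}
    {p B γ : ℝ} (hC : IsRegularSupport C μ (1 - B) B) (hp : 1 < p) (hγ : 0 < γ)
    (hγp : γ < B * p) :
    ∃ M : ℝ, 0 < M ∧ ∀ n i (x : Euc (k + 1)),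
      ENNReal.ofReal (|lineDeriv ℝ (steepStepApprox μ K n) x (EuclideanSpace.single i 1)| ^ p) ≤
        ENNReal.ofReal M * gradMajorant C K (B * p - γ) γ x := by
  have := hC.isProb
  obtain ⟨L, hL, hLb⟩ := exists_lineDeriv_avgStep_le (k := k) μ
  obtain ⟨M, hM, hMb⟩ := hC.div_mul_measure_le hp hγ hL
  refine ⟨M, hM, fun n i x => ?_⟩
  have hρ := max_cutDist_pos K n (tl x)
  have h1 := hLb _ (lipschitzWith_max_cutDist_tl K n) (fun y => max_cutDist_pos K n (tl y)) x i
  calc ENNReal.ofReal _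
      ≤ ENNReal.ofReal _ :=
        ENNReal.ofReal_le_ofReal (Real.rpow_le_rpow (abs_nonneg _) h1 (by linarith))
    _ ≤ _ := hMb _ _ hρ
    _ ≤ _ := by
        rw [gradMajorant, ENNReal.ofReal_mul hM.le, mul_assoc]
        gcongr
        exact ofReal_rpow_neg_le (by linarith) Metric.infDist_nonneg (le_max_right _ _)

lemma lineDeriv_steepStepApprox_eq_zero {C : Set ℝ} {μ : Measure ℝ} {K : Set (Fin k → ℝ)}
    {δ B : ℝ} (hC : IsRegularSupport C μ δ B) {n : ℕ} {x : Euc (k + 1)}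
    (hn : 1 / ((n : ℝ) + 4) ≤ cutDist K (tl x))
    (h : 2 * cutDist K (tl x) < cutDist C (x 0)) (i : Fin (k + 1)) :
    lineDeriv ℝ (steepStepApprox μ K n) x (EuclideanSpace.single i 1) = 0 := by
  have := hC.isProb
  obtain ⟨L, -, hLb⟩ := exists_lineDeriv_avgStep_le (k := k) μ
  have h1 := hLb _ (lipschitzWith_max_cutDist_tl K n) (fun y => max_cutDist_pos K n (tl y)) x i
  simp only [max_eq_right hn] at h1
  have h0 : μ (Metric.closedBall (x 0) (2 * cutDist K (tl x))) = 0 :=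
    hC.ball_eq_zero _ _
      (Metric.disjoint_closedBall_of_lt_infDist (h.trans_le (cutDist_le_infDist _ _)))
  rw [measureReal_def, h0, ENNReal.toReal_zero, mul_zero] at h1
  exact abs_nonpos_iff.1 h1

lemma ae_eventually_steepStepApprox_eq {K : Set (Fin k → ℝ)} {ν : Measure (Fin k → ℝ)}
    {δ A : ℝ} (hA : 0 < A) (hK : IsRegularSupport K ν δ A) (μ : Measure ℝ) :
    ∀ᵐ x : Euc (k + 1), 0 < cutDist K (tl x) ∧
      ∀ᶠ n : ℕ in atTop, 1 / ((n : ℝ) + 4) ≤ cutDist K (tl x) ∧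
        steepStepApprox μ K n =ᶠ[𝓝 x] steepStep μ K := by
  have hm : Measurable fun z : Fin k → ℝ => ENNReal.ofReal (Metric.infDist z K) ^ (-(A / 2)) := by
    have := (Metric.continuous_infDist_pt K).measurable
    fun_prop
  have hball : ∀ R : ℕ, ∀ᵐ z : Fin k → ℝ, z ∈ Metric.closedBall 0 (R : ℝ) →
      0 < Metric.infDist z K := by
    intro R
    rw [← ae_restrict_iff' Metric.isClosed_closedBall.measurableSet]
    filter_upwards [ae_lt_top hm (hK.lintegral_lt_top (A / 2) R (by linarith) (by linarith)).ne]
      with z hz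
    refine Metric.infDist_nonneg.lt_of_ne fun h => hz.ne ?_
    rw [← h, ENNReal.ofReal_zero, ENNReal.zero_rpow_of_neg (by linarith)]
  have hpos : ∀ᵐ z : Fin k → ℝ, 0 < Metric.infDist z K := by
    filter_upwards [ae_all_iff.2 hball] with z hz
    obtain ⟨R, hR⟩ := exists_nat_ge ‖z‖
    exact hz R (by simpa using hR)
  have htl : Measure.QuasiMeasurePreserving (tl : Euc (k + 1) → Fin k → ℝ) :=
    Measure.quasiMeasurePreserving_snd.comp
      (measurePreserving_splitE (k := k)).quasiMeasurePreserving
  filter_upwards [htl.ae hpos] with x hx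
  have hx' : 0 < cutDist K (tl x) := lt_min (by norm_num) hx
  exact ⟨hx', eventually_steepStepApprox_eq K μ hx'⟩

theorem steepStep_spec {C : Set ℝ} {μ : Measure ℝ} {K : Set (Fin k → ℝ)}
    {ν : Measure (Fin k → ℝ)} {δ p A B γ : ℝ} (hC : IsRegularSupport C μ (1 - B) B)
    (hK : IsRegularSupport K ν δ A) (hp : 1 < p) (hγ : 0 < γ) (hγB : γ < B)
    (hγp : γ < B * p) (hγA : B * p - γ < A) :
    HasWeakGradOn (k + 1) (steepStep μ K) (partials (steepStep μ K)) ∧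
      ∫⁻ x in Omg (k + 1), ENNReal.ofReal (‖partials (steepStep μ K) x‖ ^ p) < ⊤ ∧
      ∀ α q : ℝ, 0 < q → ∀ᵐ x ∂(volume.restrict (Omg (k + 1))),
        weight C K α x * ‖partials (steepStep μ K) x‖ ^ q = 0 := by
  have := hC.isProb
  have hp0 : 0 < p := by linarith
  have hβ : 0 < B * p - γ := by linarith
  obtain ⟨M, hM, hMb⟩ := exists_lineDeriv_steepStepApprox_le (K := K) hC hp hγ hγp
  have hG := setLIntegral_gradMajorant_lt_top hC hK hβ hγA hγ hγB
  set G := gradMajorant C K (B * p - γ) γ with hGdef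
  have hGm : Measurable G := measurable_gradMajorant _ _ _ _
  have hMG : ∫⁻ x in Omg (k + 1), ENNReal.ofReal M * G x < ⊤ := by
    rw [lintegral_const_mul _ hGm]
    exact ENNReal.mul_lt_top ENNReal.ofReal_lt_top hG
  have hfin : ∀ᵐ x ∂(volume.restrict (Omg (k + 1))), ENNReal.ofReal M * G x < ⊤ :=
    ae_lt_top (hGm.const_mul _) hMG.ne
  have hev := ae_eventually_steepStepApprox_eq (hβ.trans hγA) hK μ
  have hder : ∀ i n (x : Euc (k + 1)), ENNReal.ofReal M * G x < ⊤ →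
      |lineDeriv ℝ (steepStepApprox μ K n) x (EuclideanSpace.single i 1)| ^ p ≤
        (ENNReal.ofReal M * G x).toReal := fun i n x hx =>
    (ENNReal.ofReal_le_iff_le_toReal hx.ne).1 (hMb n i x)
  have hΩ : IsFiniteMeasure ((volume : Measure (Euc (k + 1))).restrict (Omg (k + 1))) :=
    ⟨by rw [Measure.restrict_apply_univ]; exact measure_ball_lt_top⟩
  choose Cn hCn using fun n : ℕ => lipschitzWith_avgStep μ (ε := 1 / ((n : ℝ) + 4))
    (by positivity) (lipschitzWith_max_cutDist_tl K n) (fun _ => le_max_left _ _)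
  refine ⟨hasWeakGradOn_of_approx (un := steepStepApprox μ K) (Cn := Cn) hCn (fun n x => ?_)
    (H := fun x => 1 + (ENNReal.ofReal M * G x).toReal) ?_ (fun i n => ?_) ?_, ?_, ?_⟩
  · obtain ⟨h0, h1⟩ := avgStep_mem_Icc μ (x 0) (max (1 / ((n : ℝ) + 4)) (cutDist K (tl x)))
    exact abs_le.2 ⟨by rw [steepStepApprox]; linarith, h1⟩
  · exact (integrable_const 1).add
      (integrable_toReal_of_lintegral_ne_top (hGm.const_mul _).aemeasurable hMG.ne)
  · filter_upwards [hfin] with x hx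
    set D := |lineDeriv ℝ (steepStepApprox μ K n) x (EuclideanSpace.single i 1)|
    have hD := hder i n x hx
    rcases le_total D 1 with h | h
    · exact h.trans (le_add_of_nonneg_right ENNReal.toReal_nonneg)
    · have := Real.self_le_rpow_of_one_le h hp.le
      linarith
  · filter_upwards [hev] with x hx using hx.2.mono fun n hn => hn.2
  · have hle : ∀ᵐ x ∂(volume.restrict (Omg (k + 1))),
        ENNReal.ofReal (‖partials (steepStep μ K) x‖ ^ p) ≤
          ENNReal.ofReal (√((k + 1 : ℕ) : ℝ) ^ p) * (ENNReal.ofReal M * G x) := by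
      filter_upwards [hfin, ae_restrict_of_ae hev] with x hx hx'
      obtain ⟨n, -, hn⟩ := hx'.2.exists
      set T := (ENNReal.ofReal M * G x).toReal
      have hT : 0 ≤ T := ENNReal.toReal_nonneg
      have hb : ‖partials (steepStep μ K) x‖ ≤ √((k + 1 : ℕ) : ℝ) * T ^ (1 / p) := by
        refine norm_le_of_forall_abs_le (by positivity) fun i => ?_
        have h1 := hder i n x hx
        rw [hn.lineDeriv_eq] at h1
        rw [one_div, Real.le_rpow_inv_iff_of_pos (abs_nonneg _) hT hp0]
        exact h1
      calc ENNReal.ofReal (‖partials (steepStep μ K) x‖ ^ p)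
          ≤ ENNReal.ofReal ((√((k + 1 : ℕ) : ℝ) * T ^ (1 / p)) ^ p) := by gcongr
        _ = ENNReal.ofReal (√((k + 1 : ℕ) : ℝ) ^ p) * ENNReal.ofReal T := by
            rw [Real.mul_rpow (by positivity) (by positivity), ← Real.rpow_mul hT,
              one_div_mul_cancel hp0.ne', Real.rpow_one, ENNReal.ofReal_mul (by positivity)]
        _ = _ := by rw [ENNReal.ofReal_toReal hx.ne]
    refine (lintegral_mono_ae hle).trans_lt ?_
    rw [lintegral_const_mul _ (hGm.const_mul _)]
    exact ENNReal.mul_lt_top ENNReal.ofReal_lt_top hMG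
  · intro α q hq
    filter_upwards [ae_restrict_of_ae hev] with x hx
    by_cases h : 2 * cutDist K (tl x) < cutDist C (x 0)
    · obtain ⟨n, hn, hn'⟩ := hx.2.exists
      have : partials (steepStep μ K) x = 0 := by
        ext i
        change lineDeriv ℝ (steepStep μ K) x (EuclideanSpace.single i 1) = 0
        rw [← hn'.lineDeriv_eq]
        exact lineDeriv_steepStepApprox_eq_zero hC hn h i
      rw [this, norm_zero, Real.zero_rpow hq.ne', mul_zero]
    · rw [weight, if_neg h, zero_mul]

lemma steepStep_sub_eq_zero {μ : Measure ℝ} [IsProbabilityMeasure μ]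
    (hμ : μ (Set.Icc 0 (1 / 2))ᶜ = 0) {K : Set (Fin k → ℝ)} (hKne : K.Nonempty)
    (hK : K ⊆ Set.pi Set.univ fun _ => Set.Icc 0 (1 / 2)) {x : Euc (k + 1)}
    (hx : ∃ i, 3 / 4 < |x i|) : steepStep μ K x - avgStep μ (x 0) (1 / 4) = 0 := by
  rw [sub_eq_zero, steepStep]
  split_ifs with h0
  · rfl
  have hpos : 0 < cutDist K (tl x) := (cutDist_nonneg _ _).lt_of_ne' h0
  obtain ⟨i, hi⟩ := hx
  induction i using Fin.cases with
  | zero =>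
    rcases lt_abs.1 hi with h | h
    · rw [avgStep_eq_one μ hμ hpos (by linarith [cutDist_le_quarter K (tl x)]),
        avgStep_eq_one μ hμ (by norm_num) (by linarith)]
    · rw [avgStep_eq_zero μ hμ hpos.le (by linarith),
        avgStep_eq_zero μ hμ (by norm_num) (by linarith)]
  | succ j =>
    have : (1 / 4 : ℝ) ≤ Metric.infDist (tl x) K := by
      refine (Metric.le_infDist hKne).2 fun y hy => ?_
      refine le_trans ?_ (dist_le_pi_dist (tl x) y j)
      obtain ⟨h1, h2⟩ := hK hy j (Set.mem_univ j)
      rw [Real.dist_eq]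
      have h3 : tl x j = x j.succ := rfl
      rw [h3]
      rcases lt_abs.1 hi with h | h
      · exact le_abs.2 (.inl (by linarith))
      · exact le_abs.2 (.inr (by linarith))
    rw [cutDist, min_eq_left this]

lemma mem_Omg_of_abs_lt_one {N : ℕ} (hN : 0 < N) {x : Euc N} {c : ℝ} (hc : 0 ≤ c) (hc1 : c < 1)
    (h : ∀ i, |x i| ≤ c) : x ∈ Omg N := by
  have hN' : (0 : ℝ) < √N := Real.sqrt_pos.2 (Nat.cast_pos.2 hN)
  refine mem_ball_zero_iff.2 ((norm_le_of_forall_abs_le hc h).trans_lt ?_)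
  nlinarith

lemma hasCompactSupport_of_eq_zero {N : ℕ} (hN : 0 < N) {f : Euc N → ℝ} {c : ℝ} (hc : 0 ≤ c)
    (hc1 : c < 1) (h : ∀ x : Euc N, (∃ i, c < |x i|) → f x = 0) :
    HasCompactSupport f ∧ tsupport f ⊆ Omg N := by
  set S : Set (Euc N) := {x | ∀ i, |x i| ≤ c}
  have hScl : IsClosed S := by
    simp only [S, Set.ofPred_forall]
    exact isClosed_iInter fun i => isClosed_le (by fun_prop) continuous_const
  have hsupp : Function.support f ⊆ S := fun x hx i => by
    by_contra hi
    exact hx (h x ⟨i, not_le.1 hi⟩)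
  have hts : tsupport f ⊆ S := closure_minimal hsupp hScl
  have hSΩ : S ⊆ Omg N := fun x hx => mem_Omg_of_abs_lt_one hN hc hc1 hx
  refine ⟨?_, hts.trans hSΩ⟩
  refine Metric.isCompact_of_isClosed_isBounded (isClosed_tsupport f) ?_
  exact Metric.isBounded_ball.subset (hts.trans hSΩ)

end SteepStepEnergy

lemma ofReal_sub_le_lintegral_fderiv {E : Type*} [NormedAddCommGroup E] [NormedSpace ℝ E]
    [FiniteDimensional ℝ E] {v : E → ℝ} {D Γ : NNReal} (hv : Differentiable ℝ v)
    (hD : LipschitzWith D v) {γ : ℝ → E} (hγ : LipschitzWith Γ γ) {a b : ℝ} (hab : a ≤ b) :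
    ENNReal.ofReal (v (γ b) - v (γ a)) ≤
      Γ * ∫⁻ s in Set.Ioc a b, ‖fderiv ℝ v (γ s)‖ₑ := by
  have hAC : AbsolutelyContinuousOnInterval (v ∘ γ) a b :=
    ((hD.comp hγ).lipschitzOnWith (s := Set.uIcc a b)).absolutelyContinuousOnInterval
  have hFTC := hAC.integral_deriv_eq_sub
  rw [intervalIntegral.integral_of_le hab] at hFTC
  rw [← lintegral_const_mul' _ _ ENNReal.coe_ne_top]
  calc ENNReal.ofReal (v (γ b) - v (γ a))
      = ENNReal.ofReal (∫ s in Set.Ioc a b, deriv (v ∘ γ) s) := by rw [hFTC]; rfl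
    _ ≤ ‖∫ s in Set.Ioc a b, deriv (v ∘ γ) s‖ₑ := by
        rw [← ofReal_norm]
        exact ENNReal.ofReal_le_ofReal (Real.le_norm_self _)
    _ ≤ ∫⁻ s in Set.Ioc a b, ‖deriv (v ∘ γ) s‖ₑ := enorm_integral_le_lintegral_enorm _
    _ ≤ _ := by
        refine lintegral_mono_ae (ae_restrict_of_ae ?_)
        filter_upwards [hγ.ae_differentiableAt] with s hs
        rw [((hv (γ s)).hasFDerivAt.comp_hasDerivAt s hs.hasDerivAt).deriv, mul_comm]
        refine (ContinuousLinearMap.le_opENorm _ _).trans ?_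
        gcongr
        rw [← ofReal_norm, ← ENNReal.ofReal_coe_nnreal]
        exact ENNReal.ofReal_le_ofReal (norm_deriv_le_of_lipschitz hγ)

lemma lintegral_rpow_le_weighted {X : Type*} [MeasurableSpace X] {m : Measure X} {q : ℝ}
    (hq : 1 < q) {f w : X → ℝ≥0∞} (hf : AEMeasurable f m) (hw : AEMeasurable w m)
    (hw0 : ∀ᵐ x ∂m, w x ≠ 0) (hwt : ∀ᵐ x ∂m, w x ≠ ⊤) :
    (∫⁻ x, f x ∂m) ^ q ≤
      (∫⁻ x, w x ^ (-(1 / (q - 1))) ∂m) ^ (q - 1) * ∫⁻ x, w x * f x ^ q ∂m := by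
  have hq0 : 0 < q := by linarith
  have hq1 : 0 < q - 1 := by linarith
  have hpq : (q / (q - 1)).HolderConjugate q := (Real.HolderConjugate.conjExponent hq).symm
  have h := ENNReal.lintegral_mul_le_Lp_mul_Lq m hpq (f := fun x => w x ^ (-(1 / q)))
    (g := fun x => w x ^ (1 / q) * f x) (hw.pow_const _) ((hw.pow_const _).mul hf)
  have h1 : ∫⁻ x, f x ∂m =
      ∫⁻ x, ((fun x => w x ^ (-(1 / q))) * fun x => w x ^ (1 / q) * f x) x ∂m := by
    refine lintegral_congr_ae ?_
    filter_upwards [hw0, hwt] with x h0 ht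
    rw [Pi.mul_apply, ← mul_assoc, ← ENNReal.rpow_add _ _ h0 ht, neg_add_cancel,
      ENNReal.rpow_zero, one_mul]
  rw [← h1] at h
  refine (ENNReal.rpow_le_rpow h hq0.le).trans (le_of_eq ?_)
  rw [ENNReal.mul_rpow_of_nonneg _ _ hq0.le, ← ENNReal.rpow_mul, ← ENNReal.rpow_mul,
    one_div_mul_cancel hq0.ne', ENNReal.rpow_one]
  congr 1
  · congr 1
    · refine lintegral_congr fun x => ?_
      rw [← ENNReal.rpow_mul]
      congr 1
      field_simp
    · field_simp
  · refine lintegral_congr fun x => ?_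
    rw [ENNReal.mul_rpow_of_nonneg _ _ hq0.le, ← ENNReal.rpow_mul, one_div_mul_cancel hq0.ne',
      ENNReal.rpow_one]

lemma setLIntegral_closedBall_comp_smul {k : ℕ} {F : (Fin k → ℝ) → ℝ≥0∞} (hF : Measurable F)
    (y : Fin k → ℝ) {τ : ℝ} (hτ : 0 < τ) :
    ∫⁻ ξ in Metric.closedBall 0 (1 / 2), F (y + τ • ξ) =
      ENNReal.ofReal (τ ^ (-(k : ℝ))) * ∫⁻ z in Metric.closedBall y (τ / 2), F z := by
  have hB : ∀ (x : Fin k → ℝ) r, MeasurableSet (Metric.closedBall x r) := fun x r =>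
    Metric.isClosed_closedBall.measurableSet
  set G := (Metric.closedBall y (τ / 2)).indicator F
  have hG : Measurable G := hF.indicator (hB _ _)
  have h1 : ∀ ξ, (Metric.closedBall (0 : Fin k → ℝ) (1 / 2)).indicator
      (fun ξ => F (y + τ • ξ)) ξ = G (y + τ • ξ) := fun ξ => by
    have hmem : ξ ∈ Metric.closedBall (0 : Fin k → ℝ) (1 / 2) ↔
        y + τ • ξ ∈ Metric.closedBall y (τ / 2) := by
      rw [mem_closedBall_zero_iff, mem_closedBall_iff_norm, add_sub_cancel_left, norm_smul,
        Real.norm_of_nonneg hτ.le, div_eq_mul_one_div τ 2, mul_le_mul_iff_right₀ hτ]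
    by_cases h : ξ ∈ Metric.closedBall (0 : Fin k → ℝ) (1 / 2)
    · exact (Set.indicator_of_mem h _).trans (Set.indicator_of_mem (hmem.1 h) F).symm
    · exact (Set.indicator_of_notMem h _).trans (Set.indicator_of_notMem (mt hmem.2 h) F).symm
  rw [← lintegral_indicator (hB _ _), ← lintegral_indicator (hB _ _), lintegral_congr h1]
  have hmap := Measure.map_addHaar_smul (volume : Measure (Fin k → ℝ)) hτ.ne'
  have h2 := lintegral_map (μ := (volume : Measure (Fin k → ℝ)))
    (hG.comp (measurable_const_add y)) (measurable_const_smul τ)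
  simp only [Function.comp_apply] at h2
  rw [← h2, hmap, lintegral_smul_measure, lintegral_add_left_eq_self G y, smul_eq_mul]
  congr 2
  rw [Module.finrank_fin_fun, Real.rpow_neg hτ.le, Real.rpow_natCast, abs_of_pos (by positivity)]

lemma lintegral_setLIntegral_closedBall {X : Type*} [PseudoMetricSpace X] [MeasurableSpace X]
    [OpensMeasurableSpace X] [SecondCountableTopology X] (ν m : Measure X) [SFinite ν] [SFinite m]
    {F : X → ℝ≥0∞} (hF : Measurable F) (r : ℝ) :
    ∫⁻ y, ∫⁻ z in Metric.closedBall y r, F z ∂m ∂ν =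
      ∫⁻ z, ν (Metric.closedBall z r) * F z ∂m := by
  have hS : MeasurableSet {w : X × X | dist w.2 w.1 ≤ r} :=
    (isClosed_le (by fun_prop) continuous_const).measurableSet
  have h1 : ∀ y, ∫⁻ z in Metric.closedBall y r, F z ∂m =
      ∫⁻ z, {w : X × X | dist w.2 w.1 ≤ r}.indicator (fun w => F w.2) (y, z) ∂m := fun y => by
    rw [← lintegral_indicator Metric.isClosed_closedBall.measurableSet]
    rfl
  simp_rw [h1]
  rw [lintegral_lintegral_swap (f := fun y z =>
    {w : X × X | dist w.2 w.1 ≤ r}.indicator (fun w => F w.2) (y, z))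
    ((hF.comp measurable_snd).indicator hS).aemeasurable]
  refine lintegral_congr fun z => ?_
  have h2 : ∀ y, {w : X × X | dist w.2 w.1 ≤ r}.indicator (fun w => F w.2) (y, z) =
      (Metric.closedBall z r).indicator (fun _ => F z) y := fun y => by
    by_cases h : dist z y ≤ r
    · rw [Set.indicator_of_mem (by exact h), Set.indicator_of_mem (by
        rwa [Metric.mem_closedBall, dist_comm])]
    · rw [Set.indicator_of_notMem (by exact h), Set.indicator_of_notMem (by
        rwa [Metric.mem_closedBall, dist_comm])]
  rw [lintegral_congr h2, lintegral_indicator_const Metric.isClosed_closedBall.measurableSet,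
    mul_comm]

section SmoothLowerBound

variable {k : ℕ}

lemma measurable_weight (C : Set ℝ) (K : Set (Fin k → ℝ)) (α : ℝ) : Measurable (weight C K α) := by
  have h1 : Measurable fun x : Euc (k + 1) => cutDist K (tl x) :=
    (lipschitzWith_cutDist_tl K).continuous.measurable
  have h2 : Measurable fun x : Euc (k + 1) => cutDist C (x 0) :=
    ((lipschitzWith_cutDist C).continuous.comp (by fun_prop)).measurable
  refine Measurable.ite (measurableSet_lt (h1.const_mul 2) h2) ?_ measurable_const
  exact (h2.sub (h1.const_mul 2)).pow_const α

lemma IsRegularSupport.exists_measure_closedBall_le_weight {K : Set (Fin k → ℝ)}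
    {ν : Measure (Fin k → ℝ)} {A A' α : ℝ} (hK : IsRegularSupport K ν (k - A) A') (hα : 0 ≤ α)
    (C : Set ℝ) :
    ∃ M : ℝ, 0 < M ∧ ∀ s z, 0 < cutDist C s →
      ENNReal.ofReal (cutDist C s) ^ (A + α) * (ENNReal.ofReal ((cutDist C s / 2) ^ (-(k : ℝ))) *
        ν (Metric.closedBall z (cutDist C s / 2 / 2))) ≤
      ENNReal.ofReal M * ENNReal.ofReal (weight C K α (joinE s z)) := by
  obtain ⟨c, hc, hb⟩ := hK.ball_le
  refine ⟨c * 2 ^ (k : ℝ) * (1 / 4) ^ (k - A) * 2 ^ α, by positivity, fun s z hd => ?_⟩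
  set d := cutDist C s
  rcases lt_or_ge (d / 2 / 2) (Metric.infDist z K) with h | h
  · rw [hK.ball_eq_zero _ _ (Metric.disjoint_closedBall_of_lt_infDist h)]
    simp
  have hcut : cutDist K z ≤ d / 4 := (cutDist_le_infDist K z).trans (by linarith)
  have hw : (d / 2) ^ α ≤ weight C K α (joinE s z) := by
    rw [weight, joinE_zero, tl_joinE, if_pos (by linarith)]
    exact Real.rpow_le_rpow (by positivity) (by linarith) hα
  calc _ ≤ ENNReal.ofReal (d ^ (A + α)) * (ENNReal.ofReal ((d / 2) ^ (-(k : ℝ))) *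
        ENNReal.ofReal (c * (d / 2 / 2) ^ (k - A))) := by
        rw [ENNReal.ofReal_rpow_of_pos hd]
        gcongr
        exact hb z _ (by positivity)
    _ = ENNReal.ofReal (c * 2 ^ (k : ℝ) * (1 / 4) ^ (k - A) * 2 ^ α) *
        ENNReal.ofReal ((d / 2) ^ α) := by
        rw [← ENNReal.ofReal_mul (by positivity), ← ENNReal.ofReal_mul (by positivity),
          ← ENNReal.ofReal_mul (by positivity)]
        congr 1
        have h4 : d / 2 / 2 = d * (1 / 4) := by ring
        rw [h4, Real.mul_rpow hd.le (by norm_num), Real.div_rpow hd.le (by norm_num),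
          Real.div_rpow hd.le (by norm_num), Real.rpow_neg hd.le,
          Real.rpow_neg (by norm_num : (0 : ℝ) ≤ 2), Real.rpow_add hd, Real.rpow_sub hd]
        field_simp
    _ ≤ _ := by gcongr

lemma exists_lipschitzWith_joinE (k : ℕ) :
    ∃ Γ, ∀ γ : ℝ → Fin k → ℝ, LipschitzWith 1 γ → LipschitzWith Γ fun s => joinE s (γ s) := by
  refine ⟨_, fun γ hγ => (PiLp.lipschitzWith_toLp 2 fun _ : Fin (k + 1) => ℝ).comp (Kg := 1) ?_⟩
  have h : LipschitzWith 1 fun s => (Fin.cons s (γ s) : Fin (k + 1) → ℝ) := by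
    refine LipschitzWith.of_dist_le_mul fun s s' => ?_
    rw [NNReal.coe_one, one_mul]
    refine (dist_pi_le_iff dist_nonneg).2 fun i => ?_
    refine Fin.cases le_rfl (fun j => ?_) i
    exact (dist_le_pi_dist (γ s) (γ s') j).trans (by simpa using hγ.dist_le_mul s s')
  exact h


lemma lintegral_cutDist_rpow_lt_top {C : Set ℝ} {μ : Measure ℝ} {δ B : ℝ}
    (hC : IsRegularSupport C μ δ B) {σ θ : ℝ} (hσ : 0 < σ) (hθ : 0 < θ) (h : σ * θ < B) (S : ℝ) :
    ∫⁻ s in Set.Ioc (-S) S, (ENNReal.ofReal (cutDist C s) ^ σ) ^ (-θ) < ⊤ := by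
  have hsub : Set.Ioc (-S) S ⊆ Metric.closedBall 0 S := fun s hs => by
    rw [mem_closedBall_zero_iff, Real.norm_eq_abs]
    exact abs_le.2 ⟨hs.1.le, hs.2⟩
  have hle : ∀ s, (ENNReal.ofReal (cutDist C s) ^ σ) ^ (-θ) ≤
      ENNReal.ofReal (4 ^ (σ * θ)) + ENNReal.ofReal (Metric.infDist s C) ^ (-(σ * θ)) := by
    intro s
    rw [← ENNReal.rpow_mul, mul_neg]
    rcases (cutDist_nonneg C s).eq_or_lt with h0 | h0
    · have : Metric.infDist s C = 0 := by
        rcases min_choice (1 / 4) (Metric.infDist s C) with h1 | h1 <;>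
          rw [cutDist, h1] at h0
        · norm_num at h0
        · exact h0.symm
      rw [← h0, this]
      exact le_add_self
    · rw [ENNReal.ofReal_rpow_of_pos h0]
      exact ofReal_rpow_neg_le (by positivity) Metric.infDist_nonneg le_rfl
  calc _ ≤ ∫⁻ s in Metric.closedBall 0 S, (ENNReal.ofReal (4 ^ (σ * θ)) +
        ENNReal.ofReal (Metric.infDist s C) ^ (-(σ * θ))) :=
        (lintegral_mono hle).trans (lintegral_mono_set hsub)
    _ < ⊤ := by
        rw [lintegral_add_left measurable_const]
        refine ENNReal.add_lt_top.2 ⟨?_, hC.lintegral_lt_top _ S (by positivity) h⟩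
        rw [lintegral_const, Measure.restrict_apply_univ]
        exact ENNReal.mul_lt_top ENNReal.ofReal_lt_top measure_closedBall_lt_top

lemma lipschitzWith_add_cutDist_smul (C : Set ℝ) (y : Fin k → ℝ) {ξ : Fin k → ℝ}
    (hξ : ‖ξ‖ ≤ 1) : LipschitzWith 1 fun s => y + (cutDist C s / 2) • ξ := by
  refine LipschitzWith.of_dist_le_mul fun s s' => ?_
  rw [dist_add_left, dist_eq_norm, ← sub_smul, norm_smul, Real.norm_eq_abs, ← sub_div, abs_div,
    NNReal.coe_one, one_mul]
  have h1 := abs_cutDist_sub_le C s s'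
  have h2 : |(2 : ℝ)| = 2 := by norm_num
  rw [h2]
  nlinarith [abs_nonneg (cutDist C s - cutDist C s'), norm_nonneg ξ, dist_nonneg (x := s) (y := s')]

theorem exists_rpow_le_lintegral_weight {C : Set ℝ} {μ : Measure ℝ} {K : Set (Fin k → ℝ)}
    {ν : Measure (Fin k → ℝ)} {δ A A' B α q : ℝ} (hC : IsRegularSupport C μ δ B)
    (hK : IsRegularSupport K ν (k - A) A') (hA : 0 < A) (hα : 0 ≤ α) (hq : 1 < q)
    (hAB : A + α < (q - 1) * B) (S : ℝ) (hS : 0 ≤ S) :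
    ∃ M : ℝ≥0∞, M < ⊤ ∧ ∀ (v : Euc (k + 1) → ℝ) (D : NNReal), LipschitzWith D v →
      ContDiff ℝ 1 v → ∀ t : ℝ, (∀ z z', v (joinE S z) - v (joinE (-S) z') = t) →
      ENNReal.ofReal t ^ q ≤
        M * ∫⁻ x, ENNReal.ofReal (weight C K α x) * ‖fderiv ℝ v x‖ₑ ^ q := by
  have hνp := hK.isProb
  have hq1 : 0 < q - 1 := by linarith
  obtain ⟨M, hM, hMb⟩ := hK.exists_measure_closedBall_le_weight hα C
  obtain ⟨Γ, hΓ⟩ := exists_lipschitzWith_joinE k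
  set w : ℝ → ℝ≥0∞ := fun s => ENNReal.ofReal (cutDist C s) ^ (A + α)
  have hcm : Measurable (cutDist C) := (lipschitzWith_cutDist C).continuous.measurable
  have hwm : Measurable w := by fun_prop
  set J : ℝ≥0∞ := ∫⁻ s in Set.Ioc (-S) S, w s ^ (-(1 / (q - 1)))
  have hJ : J < ⊤ := by
    refine lintegral_cutDist_rpow_lt_top hC (by linarith) (by positivity) ?_ S
    rw [mul_one_div, div_lt_iff₀ hq1]
    linarith
  have hw0 : ∀ᵐ s ∂(volume.restrict (Set.Ioc (-S) S)), w s ≠ 0 := by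
    filter_upwards [ae_lt_top (hwm.pow_const _) hJ.ne] with s hs h0
    rw [h0, ENNReal.zero_rpow_of_neg (neg_lt_zero.2 (by positivity))] at hs
    exact hs.ne rfl
  refine ⟨(Γ : ℝ≥0∞) ^ q * J ^ (q - 1) * ENNReal.ofReal M, ?_, fun v D hD hv t hvt => ?_⟩
  · refine ENNReal.mul_lt_top (ENNReal.mul_lt_top ?_ ?_) ENNReal.ofReal_lt_top
    · exact ENNReal.rpow_lt_top_of_nonneg (by linarith) ENNReal.coe_ne_top
    · exact ENNReal.rpow_lt_top_of_nonneg hq1.le hJ.ne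
  set F : Euc (k + 1) → ℝ≥0∞ := fun x => ‖fderiv ℝ v x‖ₑ ^ q
  have hhc : Continuous fun x => ‖fderiv ℝ v x‖ₑ := (hv.continuous_fderiv one_ne_zero).enorm
  have hF : Measurable F := hhc.measurable.pow_const q
  have hwt : ∀ s, w s ≠ ⊤ := fun s =>
    ENNReal.rpow_ne_top_of_nonneg (by linarith) ENNReal.ofReal_ne_top
  set m : Measure ((Fin k → ℝ) × (Fin k → ℝ)) :=
    ν.prod (volume.restrict (Metric.closedBall 0 (1 / 2)))
  have hm1 : m Set.univ = 1 := by
    rw [← Set.univ_prod_univ, Measure.prod_prod, measure_univ, Measure.restrict_apply_univ,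
      Real.volume_pi_closedBall _ (by norm_num)]
    norm_num
  have hm2 : ∀ᵐ e ∂m, ‖e.2‖ ≤ 1 := by
    refine Measure.quasiMeasurePreserving_snd.ae (p := fun ξ => ‖ξ‖ ≤ 1) ?_
    filter_upwards [ae_restrict_mem Metric.isClosed_closedBall.measurableSet] with ξ hξ
    exact (mem_closedBall_zero_iff.1 hξ).trans (by norm_num)
  set c : (Fin k → ℝ) × (Fin k → ℝ) → ℝ → Euc (k + 1) := fun e s =>
    joinE s (e.1 + (cutDist C s / 2) • e.2)
  have hcc : Continuous (Function.uncurry c) := by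
    have := (lipschitzWith_cutDist C).continuous
    have h : Continuous fun e : ((Fin k → ℝ) × (Fin k → ℝ)) × ℝ =>
        (e.2, e.1.1 + (cutDist C e.2 / 2) • e.1.2) := by fun_prop
    exact continuous_joinE.comp h
  have hcurve : ∀ᵐ e ∂m, ENNReal.ofReal t ^ q ≤
      (Γ : ℝ≥0∞) ^ q * J ^ (q - 1) * ∫⁻ s in Set.Ioc (-S) S, w s * F (c e s) := by
    filter_upwards [hm2] with e he
    have hc := hΓ _ (lipschitzWith_add_cutDist_smul C e.1 he)
    have h1 := ofReal_sub_le_lintegral_fderiv (hv.differentiable (by simp)) hD hc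
      (neg_le_self hS)
    rw [hvt] at h1
    refine (ENNReal.rpow_le_rpow h1 (by linarith)).trans ?_
    rw [ENNReal.mul_rpow_of_nonneg _ _ (by linarith), mul_assoc]
    gcongr
    exact lintegral_rpow_le_weighted hq (hhc.comp hc.continuous).measurable.aemeasurable
      hwm.aemeasurable hw0 (.of_forall hwt)
  have hslice : ∀ s, ∫⁻ e, w s * F (c e s) ∂m ≤
      ENNReal.ofReal M * ∫⁻ z, ENNReal.ofReal (weight C K α (joinE s z)) * F (joinE s z) := by
    intro s
    rcases (cutDist_nonneg C s).eq_or_lt with h0 | h0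
    · have : w s = 0 := by
        simp only [w, ← h0, ENNReal.ofReal_zero]
        exact ENNReal.zero_rpow_of_pos (by linarith)
      simp [this]
    have hFs : Measurable fun z => F (joinE s z) :=
      hF.comp (continuous_joinE.comp (by fun_prop : Continuous fun z => (s, z))).measurable
    have hcs : Measurable fun e => F (c e s) :=
      hF.comp (hcc.comp (by fun_prop : Continuous fun e => (e, s))).measurable
    have hwgt : Measurable fun z => ENNReal.ofReal (weight C K α (joinE s z)) * F (joinE s z) :=
      ((measurable_weight C K α).comp (continuous_joinE.comp
        (by fun_prop : Continuous fun z => (s, z))).measurable).ennreal_ofReal.mul hFs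
    rw [lintegral_const_mul _ hcs, lintegral_prod _ hcs.aemeasurable]
    simp only [c]
    rw [lintegral_congr fun y => setLIntegral_closedBall_comp_smul hFs y (half_pos h0),
      lintegral_const_mul' _ _ ENNReal.ofReal_ne_top, lintegral_setLIntegral_closedBall _ _ hFs,
      ← lintegral_const_mul' _ _ ENNReal.ofReal_ne_top, ← lintegral_const_mul' _ _ (hwt s),
      ← lintegral_const_mul _ hwgt]
    refine lintegral_mono fun z => ?_
    calc _ = (w s * (ENNReal.ofReal ((cutDist C s / 2) ^ (-(k : ℝ))) *
          ν (Metric.closedBall z (cutDist C s / 2 / 2)))) * F (joinE s z) := by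
          simp only [mul_assoc]
      _ ≤ _ := by
          rw [← mul_assoc (ENNReal.ofReal M)]
          exact mul_le_mul_left (hMb s z h0) _
  have hG : Measurable fun x => ENNReal.ofReal (weight C K α x) * F x :=
    (measurable_weight C K α).ennreal_ofReal.mul hF
  have hwF : Measurable fun e : ((Fin k → ℝ) × (Fin k → ℝ)) × ℝ => w e.2 * F (c e.1 e.2) :=
    (hwm.comp measurable_snd).mul (hF.comp hcc.measurable)
  calc ENNReal.ofReal t ^ q = ∫⁻ _, ENNReal.ofReal t ^ q ∂m := by
        rw [lintegral_const, hm1, mul_one]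
    _ ≤ ∫⁻ e, (Γ : ℝ≥0∞) ^ q * J ^ (q - 1) * (∫⁻ s in Set.Ioc (-S) S, w s * F (c e s)) ∂m :=
        lintegral_mono_ae hcurve
    _ = (Γ : ℝ≥0∞) ^ q * J ^ (q - 1) * ∫⁻ s in Set.Ioc (-S) S, ∫⁻ e, w s * F (c e s) ∂m := by
        rw [lintegral_const_mul _ hwF.lintegral_prod_right',
          lintegral_lintegral_swap hwF.aemeasurable]
    _ ≤ (Γ : ℝ≥0∞) ^ q * J ^ (q - 1) * ∫⁻ s, ENNReal.ofReal M *
          ∫⁻ z, ENNReal.ofReal (weight C K α (joinE s z)) * F (joinE s z) := by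
        exact mul_le_mul_right ((lintegral_mono hslice).trans (setLIntegral_le_lintegral _ _)) _
    _ = (Γ : ℝ≥0∞) ^ q * J ^ (q - 1) * ENNReal.ofReal M *
          ∫⁻ x, ENNReal.ofReal (weight C K α x) * F x := by
        have hG' : Measurable fun e : ℝ × (Fin k → ℝ) =>
            ENNReal.ofReal (weight C K α (joinE e.1 e.2)) * F (joinE e.1 e.2) :=
          hG.comp continuous_joinE.measurable
        rw [lintegral_const_mul' _ _ ENNReal.ofReal_ne_top, lintegral_euc_eq,
          Measure.volume_eq_prod, lintegral_prod _ hG'.aemeasurable, ← mul_assoc]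

end SmoothLowerBound

lemma exists_exponents {p q α κ : ℝ} (hκ : 1 ≤ κ) (hp : 1 < p) (hα : α ∈ Set.Icc (0 : ℝ) 1)
    (hq : p + α * max 1 ((p - 1) / κ) < q) :
    ∃ A B γ : ℝ, 0 < A ∧ A < κ ∧ 0 < B ∧ B < 1 ∧ A + α < (q - 1) * B ∧ 0 < γ ∧ γ < B ∧
      γ < B * p ∧ B * p - γ < A := by
  obtain ⟨hα0, hα1⟩ := hα
  set m := max 1 ((p - 1) / κ)
  have hm1 : 1 ≤ m := le_max_left _ _
  have hmκ : p - 1 ≤ m * κ := by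
    rw [← div_le_iff₀ (by linarith)]
    exact le_max_right _ _
  set η := q - p - α * m
  have hη : 0 < η := by linarith
  have hqη : q - 1 = p - 1 + α * m + η := by ring
  set x := m + η / 4
  have hx : 0 < x := by positivity
  have hA : 0 < (p - 1 + η / 8) / x := div_pos (by linarith) hx
  have hAB : 1 / x * p - (p - 1 + η / 8) / x < 1 / x := by
    rw [one_div_mul_eq_div, ← sub_div, div_lt_div_iff_of_pos_right hx]
    linarith
  obtain ⟨γ, hγ, hγB⟩ := exists_between (max_lt (one_div_pos.2 hx) hAB)
  obtain ⟨hγ0, hγA⟩ := max_lt_iff.1 hγ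
  refine ⟨(p - 1 + η / 8) / x, 1 / x, γ, hA, ?_, one_div_pos.2 hx, ?_, ?_, hγ0, hγB, ?_,
    by linarith⟩
  · rw [div_lt_iff₀ hx]
    simp only [x]
    nlinarith
  · rw [div_lt_one hx]
    simp only [x]
    linarith
  · rw [mul_one_div, lt_div_iff₀ hx, add_mul, div_mul_cancel₀ _ hx.ne', hqη]
    simp only [x]
    nlinarith
  · exact hγB.trans (lt_mul_of_one_lt_right (one_div_pos.2 hx) hp)

section Weight

variable {k : ℕ}

lemma weight_nonneg (C : Set ℝ) (K : Set (Fin k → ℝ)) (α : ℝ) (x : Euc (k + 1)) :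
    0 ≤ weight C K α x := by
  unfold weight
  split_ifs with h
  · exact Real.rpow_nonneg (by linarith) _
  · rfl

lemma weight_le_one (C : Set ℝ) (K : Set (Fin k → ℝ)) {α : ℝ} (hα : 0 ≤ α) (x : Euc (k + 1)) :
    weight C K α x ≤ 1 := by
  unfold weight
  split_ifs with h
  · have := cutDist_nonneg K (tl x)
    have := cutDist_le_quarter C (x 0)
    exact Real.rpow_le_one (by linarith) (by linarith) hα
  · exact zero_le_one

lemma abs_rpow_sub_rpow_le {a b α : ℝ} (ha : 0 ≤ a) (hb : 0 ≤ b) (hα : 0 ≤ α) (hα1 : α ≤ 1) :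
    |a ^ α - b ^ α| ≤ |a - b| ^ α := by
  wlog hab : b ≤ a generalizing a b
  · rw [abs_sub_comm, abs_sub_comm a]
    exact this hb ha (le_of_not_ge hab)
  rw [abs_of_nonneg (sub_nonneg.2 (Real.rpow_le_rpow hb hab hα)), abs_of_nonneg (sub_nonneg.2 hab)]
  have := Real.rpow_add_le_add_rpow (sub_nonneg.2 hab) hb hα hα1
  rw [sub_add_cancel] at this
  linarith

lemma abs_weight_sub_le (C : Set ℝ) (K : Set (Fin k → ℝ)) {α : ℝ} (hα : 0 < α) (hα1 : α ≤ 1)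
    (x y : Euc (k + 1)) : |weight C K α x - weight C K α y| ≤ 3 ^ α * dist x y ^ α := by
  have hmax : ∀ x : Euc (k + 1),
      weight C K α x = (max 0 (cutDist C (x 0) - 2 * cutDist K (tl x))) ^ α := by
    intro x
    unfold weight
    split_ifs with h
    · rw [max_eq_right (by linarith)]
    · rw [max_eq_left (by linarith), Real.zero_rpow hα.ne']
  rw [hmax, hmax, ← Real.mul_rpow (by norm_num) dist_nonneg]
  refine (abs_rpow_sub_rpow_le (le_max_left _ _) (le_max_left _ _) hα.le hα1).trans ?_
  refine Real.rpow_le_rpow (abs_nonneg _) ?_ hα.le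
  have h1 := (abs_cutDist_sub_le C (x 0) (y 0)).trans (abs_apply_sub_le_dist x y 0)
  have h2 := (abs_cutDist_sub_le K (tl x) (tl y)).trans (dist_tl_le x y)
  refine (abs_max_sub_max_le_max _ _ _ _).trans (max_le (by simp) ?_)
  rw [abs_le] at *
  constructor <;> linarith [h1.1, h1.2, h2.1, h2.2]

lemma weight_eq_zero_or_abs_gt {C : Set ℝ} {K : Set (Fin k → ℝ)} {α : ℝ} (hKne : K.Nonempty)
    (hK : K ⊆ Set.pi Set.univ fun _ => Set.Icc 0 (1 / 2)) {x : Euc (k + 1)}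
    (hx : x ∉ Omg (k + 1)) : weight C K α x = 0 ∨ 3 / 4 < |x 0| := by
  by_contra! h
  obtain ⟨hw, h0⟩ := h
  have hlt : 2 * cutDist K (tl x) < cutDist C (x 0) := by
    by_contra hlt
    exact hw (if_neg hlt)
  have hinf : Metric.infDist (tl x) K < 1 / 4 := by
    by_contra! hge
    rw [cutDist, min_eq_left hge] at hlt
    linarith [cutDist_le_quarter C (x 0)]
  obtain ⟨y, hy, hxy⟩ := (Metric.infDist_lt_iff hKne).1 hinf
  refine hx (mem_Omg_of_abs_lt_one (c := 3 / 4) k.succ_pos (by norm_num) (by norm_num) fun i => ?_)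
  refine Fin.cases h0 (fun j => ?_) i
  have h1 := (dist_le_pi_dist (tl x) y j).trans hxy.le
  obtain ⟨h2, h3⟩ := hK hy j (Set.mem_univ j)
  rw [Real.dist_eq, abs_le] at h1
  have h4 : tl x j = x j.succ := rfl
  rw [h4] at h1
  exact abs_le.2 ⟨by linarith [h1.1], by linarith [h1.2]⟩

lemma joinE_notMem_Omg {s : ℝ} (hs : √((k + 1 : ℕ) : ℝ) ≤ |s|) (z : Fin k → ℝ) :
    joinE s z ∉ Omg (k + 1) := by
  intro h
  have h1 := PiLp.norm_apply_le (joinE s z) 0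
  rw [joinE_zero, Real.norm_eq_abs] at h1
  exact absurd (mem_ball_zero_iff.1 h) (not_lt.2 (hs.trans h1))

end Weight

section SmoothCompetitors

variable {k : ℕ} {μ : Measure ℝ} [IsProbabilityMeasure μ]

lemma contDiff_avgStep_apply_zero (hμ : μ (Set.Icc 0 (1 / 2))ᶜ = 0) :
    ContDiff ℝ (⊤ : ℕ∞) fun x : Euc (k + 1) => avgStep μ (x 0) (1 / 4) :=
  (contDiff_avgStep μ hμ).comp (contDiff_piLp_apply (p := 2) (i := (0 : Fin (k + 1))))

lemma fderiv_avgStep_apply_zero (hμ : μ (Set.Icc 0 (1 / 2))ᶜ = 0) {x : Euc (k + 1)}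
    (hx : 3 / 4 < |x 0|) : fderiv ℝ (fun x : Euc (k + 1) => avgStep μ (x 0) (1 / 4)) x = 0 := by
  have hcont : Continuous fun y : Euc (k + 1) => y 0 := by fun_prop
  rcases lt_abs.1 hx with h | h
  · have : (fun x : Euc (k + 1) => avgStep μ (x 0) (1 / 4)) =ᶠ[𝓝 x] fun _ => 1 := by
      filter_upwards [hcont.continuousAt.eventually (lt_mem_nhds h)] with y hy
      exact avgStep_eq_one μ hμ (by norm_num) (by linarith)
    rw [this.fderiv_eq, fderiv_fun_const, Pi.zero_apply]
  · have : (fun x : Euc (k + 1) => avgStep μ (x 0) (1 / 4)) =ᶠ[𝓝 x] fun _ => 0 := by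
      filter_upwards [hcont.continuousAt.eventually (gt_mem_nhds (lt_neg.1 h))] with y hy
      exact avgStep_eq_zero μ hμ (by norm_num) (by linarith)
    rw [this.fderiv_eq, fderiv_fun_const, Pi.zero_apply]

lemma norm_smul_gradient_add_gradient {E : Type*} [NormedAddCommGroup E] [InnerProductSpace ℝ E]
    [CompleteSpace E] {u φ : E → ℝ} {x : E} (hu : DifferentiableAt ℝ u x)
    (hφ : DifferentiableAt ℝ φ x) (t : ℝ) :
    ‖t • gradient u x + gradient φ x‖ = ‖fderiv ℝ (fun y => t * u y + φ y) x‖ := by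
  have h : fderiv ℝ (fun y => t * u y + φ y) x = t • fderiv ℝ u x + fderiv ℝ φ x := by
    rw [fderiv_fun_add (hu.const_mul t) hφ, fderiv_const_mul hu]
  rw [h, ← LinearIsometryEquiv.norm_map (InnerProductSpace.toDual ℝ E).symm (_ + _)]
  simp [gradient]

lemma exists_rpow_le_energy {C : Set ℝ} {K : Set (Fin k → ℝ)} {ν : Measure (Fin k → ℝ)}
    {δ A A' B α p q : ℝ} (hC : IsRegularSupport C μ δ B) (hK : IsRegularSupport K ν (k - A) A')
    (hμ : μ (Set.Icc 0 (1 / 2))ᶜ = 0) (hKsub : K ⊆ Set.pi Set.univ fun _ => Set.Icc 0 (1 / 2))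
    (hA : 0 < A) (hα : 0 ≤ α) (hq : 1 < q) (hAB : A + α < (q - 1) * B) :
    ∃ M : ℝ≥0∞, M < ⊤ ∧ ∀ t φ, IsTestFun (k + 1) φ →
      ENNReal.ofReal t ^ q ≤ M * ∫⁻ x in Omg (k + 1), ENNReal.ofReal
        (‖t • gradient (fun x : Euc (k + 1) => avgStep μ (x 0) (1 / 4)) x + gradient φ x‖ ^ p +
          weight C K α x *
            ‖t • gradient (fun x : Euc (k + 1) => avgStep μ (x 0) (1 / 4)) x +
              gradient φ x‖ ^ q) := by
  set u : Euc (k + 1) → ℝ := fun x => avgStep μ (x 0) (1 / 4) with hu_def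
  have hu : ContDiff ℝ (⊤ : ℕ∞) u := contDiff_avgStep_apply_zero hμ
  have hq0 : 0 < q := by linarith
  set S : ℝ := √((k + 1 : ℕ) : ℝ) + 1
  have hS : √((k + 1 : ℕ) : ℝ) ≤ S := by simp [S]
  have hS1 : 1 ≤ S := by simp [S]
  obtain ⟨M, hM, H⟩ := exists_rpow_le_lintegral_weight hC hK hA hα hq hAB S (by linarith)
  refine ⟨M, hM, fun t φ hφ => ?_⟩
  have hud : Differentiable ℝ u := hu.differentiable (by simp)
  have hφd : Differentiable ℝ φ := hφ.1.differentiable (by simp)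
  obtain ⟨D₁, hD₁⟩ := lipschitzWith_avgStep (k := k) μ (ρ := fun _ => 1 / 4) (ε := 1 / 4)
    (by norm_num) (LipschitzWith.const' _) fun _ => le_rfl
  obtain ⟨D₂, hD₂⟩ := hφ.exists_lipschitzWith
  have hφ0 : ∀ x ∉ Omg (k + 1), φ x = 0 := fun x hx =>
    image_eq_zero_of_notMem_tsupport fun h => hx (hφ.2.2 h)
  have hends : ∀ z z' : Fin k → ℝ, (t * u (joinE S z) + φ (joinE S z)) -
      (t * u (joinE (-S) z') + φ (joinE (-S) z')) = t := by
    intro z z'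
    rw [hφ0 _ (joinE_notMem_Omg (hS.trans (le_abs_self S)) z),
      hφ0 _ (joinE_notMem_Omg (hS.trans ((le_abs_self S).trans (abs_neg S).ge)) z')]
    simp only [hu_def, joinE_zero]
    rw [avgStep_eq_one μ hμ (by norm_num) (by linarith),
      avgStep_eq_zero μ hμ (by norm_num) (by linarith)]
    ring
  refine (H (fun x => t * u x + φ x) _ (((lipschitzWith_smul t).comp hD₁).add hD₂)
    (((contDiff_const.mul hu).add hφ.1).of_le (by simp)) t hends).trans ?_
  refine mul_le_mul_right ?_ M
  calc ∫⁻ x, ENNReal.ofReal (weight C K α x) * ‖fderiv ℝ (fun x => t * u x + φ x) x‖ₑ ^ q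
      = ∫⁻ x in Omg (k + 1),
          ENNReal.ofReal (weight C K α x) * ‖fderiv ℝ (fun x => t * u x + φ x) x‖ₑ ^ q := by
        refine (setLIntegral_eq_of_support_subset fun x hx => ?_).symm
        by_contra hxΩ
        refine hx ?_
        rcases weight_eq_zero_or_abs_gt (C := C) (α := α) hK.nonempty hKsub hxΩ with h | h
        · simp [h]
        · have h0 : fderiv ℝ φ x = 0 := image_eq_zero_of_notMem_tsupport fun hx' =>
            hxΩ (hφ.2.2 (tsupport_fderiv_subset ℝ hx'))
          have h1 : fderiv ℝ u x = 0 := fderiv_avgStep_apply_zero hμ h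
          have h2 : ‖fderiv ℝ (fun x => t * u x + φ x) x‖ₑ = 0 := by
            rw [← ofReal_norm, fderiv_fun_add ((hud x).const_mul t) (hφd x), fderiv_const_mul (hud x), h0, h1,
              smul_zero, add_zero, norm_zero, ENNReal.ofReal_zero]
          simp only [h2, ENNReal.zero_rpow_of_pos hq0, mul_zero]
    _ ≤ _ := by
        refine lintegral_mono fun x => ?_
        rw [norm_smul_gradient_add_gradient (hud x) (hφd x), ← ofReal_norm,
          ENNReal.ofReal_rpow_of_nonneg (norm_nonneg _) hq0.le,
          ← ENNReal.ofReal_mul (weight_nonneg C K α x)]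
        exact ENNReal.ofReal_le_ofReal (le_add_of_nonneg_left (by positivity))

end SmoothCompetitors

/-- Theorem A (0-form case), W-minimizer ≠ H-minimizer for the Dirichlet problem
for the double phase integrand `Φ(x,t) = t^p + a(x) t^q`: a Sobolev competitor
with boundary values `t·u^∂` has strictly smaller energy than the infimum of the
energies of all smooth competitors with the same boundary values. -/
theorem statement6 (N : ℕ) (hN : 2 ≤ N) (p q α : ℝ) (hp : 1 < p)
    (hα : α ∈ Set.Icc (0 : ℝ) 1)
    (hq : p + α * max 1 ((p - 1) / ((N : ℝ) - 1)) < q) :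
    ∃ (a : Euc N → ℝ) (ubd : Euc N → ℝ) (t₀ : ℝ),
      -- the weight: nonnegative, bounded, Hölder of exponent α (Lipschitz if α = 1)
      (∀ x, 0 ≤ a x) ∧ (∃ M : ℝ, ∀ x, a x ≤ M) ∧
      (0 < α → ∃ L : ℝ, ∀ x y, |a x - a y| ≤ L * dist x y ^ α) ∧
      -- the boundary datum
      ContDiff ℝ (⊤ : ℕ∞) ubd ∧ 0 < t₀ ∧
      ∀ t : ℝ, t₀ ≤ t →
        ∃ (w : Euc N → ℝ) (g : Euc N → Euc N),
          HasWeakGradOn N w g ∧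
          (∃ M : ℝ, ∀ x, |w x - t * ubd x| ≤ M) ∧
          HasCompactSupport (fun x => w x - t * ubd x) ∧
          tsupport (fun x => w x - t * ubd x) ⊆ Omg N ∧
          (∫⁻ x in Omg N, ENNReal.ofReal (‖g x‖ ^ p + a x * ‖g x‖ ^ q)) < ⊤ ∧
          (∫⁻ x in Omg N, ENNReal.ofReal (‖g x‖ ^ p + a x * ‖g x‖ ^ q)) <
            sInf { r : ℝ≥0∞ | ∃ φ : Euc N → ℝ, IsTestFun N φ ∧
              r = ∫⁻ x in Omg N, ENNReal.ofReal
                    (‖t • gradient ubd x + gradient φ x‖ ^ p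
                      + a x * ‖t • gradient ubd x + gradient φ x‖ ^ q) } := by
  obtain ⟨k, rfl⟩ : ∃ k, N = k + 1 := ⟨N - 1, by omega⟩
  have hk : 0 < k := by omega
  have hk0 : (0 : ℝ) < k := by exact_mod_cast hk
  have hk1 : (1 : ℝ) ≤ k := by exact_mod_cast hk
  have hα0 : 0 ≤ α := hα.1
  have hpq : p < q := by
    have : 0 ≤ α * max 1 ((p - 1) / (((k + 1 : ℕ) : ℝ) - 1)) :=
      mul_nonneg hα0 (zero_le_one.trans (le_max_left _ _))
    linarith
  have hp0 : 0 < p := by linarith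
  have hq0 : 0 < q := by linarith
  rw [show ((k + 1 : ℕ) : ℝ) - 1 = k by push_cast; ring] at hq
  obtain ⟨A, B, γ, hA, hAk, hB, hB1, hAB, hγ, hγB, hγp, hγA⟩ := exists_exponents hk1 hp hα hq
  obtain ⟨C, μ, hCsub, hμ, hC⟩ := exists_isRegularSupport (δ := 1 - B) (by linarith) (by linarith)
  rw [sub_sub_cancel] at hC
  have hAk1 : A / k < 1 := (div_lt_one hk0).2 hAk
  have hAk0 : 0 < A / k := by positivity
  obtain ⟨C', μ', hC'sub, -, hC'⟩ :=
    exists_isRegularSupport (δ := 1 - A / k) (by linarith) (by linarith)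
  have hK := hC'.pi hk
  rw [sub_sub_cancel, mul_sub, mul_one, mul_div_cancel₀ A hk0.ne'] at hK
  set K : Set (Fin k → ℝ) := Set.pi Set.univ fun _ => C'
  set ν : Measure (Fin k → ℝ) := Measure.pi fun _ => μ'
  have hKsub : K ⊆ Set.pi Set.univ fun _ => Set.Icc 0 (1 / 2) :=
    Set.pi_mono fun _ _ => hC'sub
  have := hC.isProb
  obtain ⟨M, hM, hlow⟩ :=
    exists_rpow_le_energy (p := p) hC hK hμ hKsub hA hα0 (hp.trans hpq) hAB
  obtain ⟨hweak, hfin, hzero⟩ := steepStep_spec hC hK hp hγ hγB hγp hγA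
  set E := ∫⁻ x in Omg (k + 1), ENNReal.ofReal (‖partials (steepStep μ K) x‖ ^ p) with hE
  obtain ⟨T, hT⟩ := eventually_atTop.1 ((tendsto_rpow_atTop (sub_pos.2 hpq)).eventually_gt_atTop
    (M.toReal * (E.toReal + 1)))
  refine ⟨weight C K α, fun x => avgStep μ (x 0) (1 / 4), max T 1, weight_nonneg C K α,
    ⟨1, weight_le_one C K hα0⟩, fun h => ⟨3 ^ α, abs_weight_sub_le C K h hα.2⟩,
    contDiff_avgStep_apply_zero hμ, by positivity, fun t ht => ?_⟩
  have hT' := hT t ((le_max_left _ _).trans ht)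
  have ht0 : 0 < t := zero_lt_one.trans_le ((le_max_right _ _).trans ht)
  have hen : ∫⁻ x in Omg (k + 1), ENNReal.ofReal (‖t • partials (steepStep μ K) x‖ ^ p +
      weight C K α x * ‖t • partials (steepStep μ K) x‖ ^ q) = ENNReal.ofReal (t ^ p * E.toReal) := by
    rw [ENNReal.ofReal_mul (by positivity), ENNReal.ofReal_toReal hfin.ne, hE,
      ← lintegral_const_mul' _ _ ENNReal.ofReal_ne_top]
    refine lintegral_congr_ae ?_
    filter_upwards [hzero α q hq0] with x hx
    rw [norm_smul, mul_rpow (norm_nonneg _) (norm_nonneg _),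
      mul_rpow (norm_nonneg _) (norm_nonneg _), mul_left_comm, hx, mul_zero, add_zero,
      Real.norm_of_nonneg ht0.le, ENNReal.ofReal_mul (by positivity)]
  obtain ⟨hsupp, hsub⟩ := hasCompactSupport_of_eq_zero k.succ_pos
    (f := fun x => t * steepStep μ K x - t * avgStep μ (x 0) (1 / 4)) (c := 3 / 4) (by norm_num)
    (by norm_num) fun x hx => by
      rw [← mul_sub, steepStep_sub_eq_zero hμ hK.nonempty hKsub hx, mul_zero]
  refine ⟨fun x => t * steepStep μ K x, fun x => t • partials (steepStep μ K) x,
    hweak.const_mul t, ⟨t, fun x => ?_⟩, hsupp, hsub, ?_, ?_⟩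
  · have h1 : steepStep μ K x ∈ Set.Icc (0 : ℝ) 1 := by
      unfold steepStep
      split_ifs <;> exact avgStep_mem_Icc _ _ _
    have h2 := avgStep_mem_Icc μ (x 0) (1 / 4)
    rw [← mul_sub, abs_mul, abs_of_pos ht0]
    exact mul_le_of_le_one_right ht0.le
      (abs_le.2 ⟨by linarith [h1.1, h2.2], by linarith [h1.2, h2.1]⟩)
  · rw [hen]
    exact ENNReal.ofReal_lt_top
  · rw [hen]
    refine ((ENNReal.ofReal_lt_ofReal_iff (by positivity)).2
      (mul_lt_mul_of_pos_left (lt_add_one E.toReal) (by positivity))).trans_le (le_sInf ?_)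
    rintro r ⟨φ, hφ, rfl⟩
    by_contra! hlt
    have h1 := (hlow t φ hφ).trans (by gcongr : _ ≤ M * ENNReal.ofReal (t ^ p * (E.toReal + 1)))
    rw [← ENNReal.ofReal_toReal hM.ne, ← ENNReal.ofReal_mul ENNReal.toReal_nonneg,
      ENNReal.ofReal_rpow_of_pos ht0, ENNReal.ofReal_le_ofReal_iff (by positivity)] at h1
    rw [Real.rpow_sub ht0, lt_div_iff₀ (by positivity)] at hT'
    linarith

end
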